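/- Under the standing assumptions, for each R>0 and ω∈Ω there exists C=C(R)>0 such that, if v^{i,δ} is the solution of the approximate macroscopic system corresponding to (p_i,r_i)∈B_R×B_R (i=1,2), then max_{1≤k≤m}‖δv^{1,δ}_k−δv^{2,δ}_k‖_{L^∞(ℝⁿ)} ≤ C·max_{1≤k≤m}((1+|p₁|+|p₂|)^{γ_k−1}|p₁−p₂|+|r₁−r₂|). -/

import Mathlib

open Filter Topology Matrix

noncomputable section

/-- Euclidean space ℝⁿ. -/
abbrev Euc (n : ℕ) := EuclideanSpace ℝ (Fin n)

/-- The Hessian matrix of a (test) function `φ : ℝⁿ → ℝ` at a point `y`. -/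
def hess {n : ℕ} (φ : Euc n → ℝ) (y : Euc n) : Matrix (Fin n) (Fin n) ℝ :=
  fun i j =>
    iteratedFDeriv ℝ 2 φ y ![EuclideanSpace.single i (1 : ℝ), EuclideanSpace.single j (1 : ℝ)]

/-- `max_{i ≠ k} (s i)₊`, the positive-part maximum over the indices other than `k`. -/
def posMaxOff {m : ℕ} (k : Fin m) (s : Fin m → ℝ) : ℝ :=
  (((Finset.univ.erase k).sup fun i => (s i).toNNReal : NNReal) : ℝ)

/-- `v` is a viscosity subsolution on `U` of the system `G_k(y, v(y), Dv_k, D²v_k) = 0`,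
`k = 1, …, m`. -/
def IsViscSubOn {n m : ℕ}
    (G : Fin m → Euc n → (Fin m → ℝ) → Euc n → Matrix (Fin n) (Fin n) ℝ → ℝ)
    (U : Set (Euc n)) (v : Fin m → Euc n → ℝ) : Prop :=
  ∀ k : Fin m, ∀ φ : Euc n → ℝ, ContDiff ℝ 2 φ →
    ∀ y₀ ∈ U, IsLocalMaxOn (fun y => v k y - φ y) U y₀ →
      G k y₀ (fun j => v j y₀) (gradient φ y₀) (hess φ y₀) ≤ 0

/-- `v` is a viscosity supersolution on `U` of the system `G_k(y, v(y), Dv_k, D²v_k) = 0`. -/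
def IsViscSupOn {n m : ℕ}
    (G : Fin m → Euc n → (Fin m → ℝ) → Euc n → Matrix (Fin n) (Fin n) ℝ → ℝ)
    (U : Set (Euc n)) (v : Fin m → Euc n → ℝ) : Prop :=
  ∀ k : Fin m, ∀ φ : Euc n → ℝ, ContDiff ℝ 2 φ →
    ∀ y₀ ∈ U, IsLocalMinOn (fun y => v k y - φ y) U y₀ →
      0 ≤ G k y₀ (fun j => v j y₀) (gradient φ y₀) (hess φ y₀)

/-- Viscosity solution of the system `G_k = 0` on `U`. -/
def IsViscSolnOn {n m : ℕ}
    (G : Fin m → Euc n → (Fin m → ℝ) → Euc n → Matrix (Fin n) (Fin n) ℝ → ℝ)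
    (U : Set (Euc n)) (v : Fin m → Euc n → ℝ) : Prop :=
  IsViscSubOn G U v ∧ IsViscSupOn G U v

/-- The standing assumptions: a probability space `(Ω, 𝓕, P)` with an ergodic group
`(τ_y)` of measure-preserving transformations, diffusion matrices `A_k = Σ_k Σ_kᵗ` and
Hamiltonians `H_k(p, r, s, y, ω)`, stationary, convex and coercive in `(p, s)`, monotone,
bounded on bounded sets and locally Lipschitz continuous.  The difference variable
`s ∈ ℝ^{m-1}` is encoded as a vector `s : Fin m → ℝ` whose `k`-th entry is irrelevant
(it is always `0 = v_k - v_k` when evaluated on differences). -/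
structure Setting (n m : ℕ) where
  Ω : Type
  [mΩ : MeasurableSpace Ω]
  P : MeasureTheory.Measure Ω
  [probP : MeasureTheory.IsProbabilityMeasure P]
  τ : Euc n → Ω → Ω
  A : Fin m → Euc n → Ω → Matrix (Fin n) (Fin n) ℝ
  Sig : Fin m → Euc n → Ω → Matrix (Fin n) (Fin n) ℝ
  H : Fin m → Euc n → (Fin m → ℝ) → (Fin m → ℝ) → Euc n → Ω → ℝ
  γ : Fin m → ℝ
  τ_zero : τ 0 = id
  τ_add : ∀ y z : Euc n, τ (y + z) = τ y ∘ τ z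
  τ_measurePreserving : ∀ y, MeasureTheory.MeasurePreserving (τ y) P P
  ergodic : ∀ E : Set Ω, MeasurableSet E → (∀ y, τ y ⁻¹' E = E) → P E = 0 ∨ P E = 1
  A_stat : ∀ k y z ω, A k (y + z) ω = A k y (τ z ω)
  H_stat : ∀ k p r s y z ω, H k p r s (y + z) ω = H k p r s y (τ z ω)
  H_convex_p : ∀ k r s y ω, ConvexOn ℝ Set.univ fun p => H k p r s y ω
  H_convex_s : ∀ k p r y ω, ConvexOn ℝ Set.univ fun s => H k p r s y ω
  γ_gt_one : ∀ k, 1 < γ k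
  coercive : ∀ R : ℝ, 0 < R → ∃ C₁ C₂ C₃ : ℝ, 0 < C₁ ∧ 0 < C₂ ∧ 0 < C₃ ∧
    ∀ k p r s y ω, ‖r‖ ≤ R →
      C₁ * ‖p‖ ^ γ k + C₂ * posMaxOff k s - C₃ ≤ H k p r s y ω
  A_sq : ∀ k y ω, A k y ω = Sig k y ω * (Sig k y ω)ᵀ
  Sig_lip : ∃ C : ℝ, 0 < C ∧ ∀ k ω i j, (∀ y, |Sig k y ω i j| ≤ C) ∧
    ∀ y₁ y₂, |Sig k y₁ ω i j - Sig k y₂ ω i j| ≤ C * ‖y₁ - y₂‖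
  H_mono_rk : ∀ k p r s y ω t t', t ≤ t' →
    H k p (Function.update r k t) s y ω ≤ H k p (Function.update r k t') s y ω
  H_mono_s : ∀ k p r s y ω i t t', t ≤ t' →
    H k p r (Function.update s i t) y ω ≤ H k p r (Function.update s i t') y ω
  H_antitone_r : ∀ k p r s y ω i t t', i ≠ k → t ≤ t' →
    H k p (Function.update r i t') s y ω ≤ H k p (Function.update r i t) s y ω
  H_bounded : ∀ R : ℝ, 0 < R → ∃ C₄ : ℝ, 0 < C₄ ∧ ∀ k p r s y ω,
    ‖p‖ ≤ R → ‖r‖ ≤ R → ‖s‖ ≤ R → |H k p r s y ω| ≤ C₄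
  H_cont : ∀ R : ℝ, 0 < R → ∃ C₅ : ℝ, 0 < C₅ ∧ ∀ k p₁ p₂ r₁ r₂ s₁ s₂ y₁ y₂ ω,
    ‖r₁‖ ≤ R → ‖r₂‖ ≤ R → ‖s₁‖ ≤ R → ‖s₂‖ ≤ R →
    |H k p₁ r₁ s₁ y₁ ω - H k p₂ r₂ s₂ y₂ ω| ≤
      C₅ * ((1 + ‖p₁‖ + ‖p₂‖) ^ (γ k - 1) * ‖p₁ - p₂‖ + ‖r₁ - r₂‖ + ‖s₁ - s₂‖ + ‖y₁ - y₂‖)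
  H_colmon : ∀ k p (r q : Fin m → ℝ) s y ω, (∀ i, |r i - q i| ≤ r k - q k) →
    H k p q s y ω ≤ H k p r s y ω

attribute [instance] Setting.mΩ Setting.probP

open MeasureTheory

/-- The operator of the approximate macroscopic system
`δ v_k − tr(A_k(y,ω) D²v_k) + H_k(p + Dv_k, r̂, v_k − v_j, y, ω) = 0`. -/
def macroOp {n m : ℕ} (S : Setting n m) (p : Euc n) (r δ : ℝ) (ω : S.Ω) :
    Fin m → Euc n → (Fin m → ℝ) → Euc n → Matrix (Fin n) (Fin n) ℝ → ℝ :=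
  fun k y vals q X =>
    δ * vals k - (S.A k y ω * X).trace +
      S.H k (p + q) (fun _ => r) (fun j => vals k - vals j) y ω

/-- `v` is "the" solution of the approximate macroscopic system: a continuous, bounded,
Lipschitz (i.e. bounded-gradient) viscosity solution on all of `ℝⁿ`. -/
def IsMacroSoln {n m : ℕ} (S : Setting n m) (p : Euc n) (r δ : ℝ) (ω : S.Ω)
    (v : Fin m → Euc n → ℝ) : Prop :=
  (∀ k, Continuous (v k)) ∧ (∃ B : ℝ, ∀ k y, |v k y| ≤ B) ∧
  (∃ L : NNReal, ∀ k, LipschitzWith L (v k)) ∧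
  IsViscSolnOn (macroOp S p r δ ω) Set.univ v

/-- The stationary cell/metric operator at level `μ`:
`−tr(A_k(y,ω) D²v_k) + H_k(p + Dv_k, r̂, v_k − v_j, y, ω) − μ = 0`. -/
def statOp {n m : ℕ} (S : Setting n m) (p : Euc n) (r μ : ℝ) (ω : S.Ω) :
    Fin m → Euc n → (Fin m → ℝ) → Euc n → Matrix (Fin n) (Fin n) ℝ → ℝ :=
  fun k y vals q X =>
    -(S.A k y ω * X).trace +
      S.H k (p + q) (fun _ => r) (fun j => vals k - vals j) y ω - μ

/-- `u` grows at most linearly at infinity (`limsup_{|y|→∞} u(y)/|y| < ∞`). -/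
def SublinearAbove {n : ℕ} (u : Euc n → ℝ) : Prop :=
  ∃ C : ℝ, ∀ᶠ y in Bornology.cobounded (Euc n), u y ≤ C * ‖y‖

/-- `liminf_{|y|→∞} u(y)/|y| ≥ 0`. -/
def SublinearBelow {n : ℕ} (u : Euc n → ℝ) : Prop :=
  ∀ ε : ℝ, 0 < ε → ∀ᶠ y in Bornology.cobounded (Euc n), -(ε * ‖y‖) ≤ u y

/-- A Lipschitz, sublinearly growing global viscosity subsolution of the cell problem at
level `lam`. -/
def IsCellSub {n m : ℕ} (S : Setting n m) (p : Euc n) (r lam : ℝ) (ω : S.Ω)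
    (w : Fin m → Euc n → ℝ) : Prop :=
  (∃ L : NNReal, ∀ k, LipschitzWith L (w k)) ∧
  IsViscSubOn (statOp S p r lam ω) Set.univ w ∧
  ∀ k, Tendsto (fun y => w k y / ‖y‖) (Bornology.cobounded (Euc n)) (𝓝 0)

/-- `γ = min_k γ_k`. -/
def gammaMin {n m : ℕ} (S : Setting n (m + 1)) : ℝ :=
  Finset.univ.inf' ⟨0, Finset.mem_univ 0⟩ S.γ

/-- The case distinction: every `A_k` vanishes identically, or `γ > 2`. -/
def degenCase {n m : ℕ} (S : Setting n (m + 1)) : Prop :=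
  (∀ k y ω, S.A k y ω = 0) ∨ 2 < gammaMin S

open Classical in
/-- The excised set `D₁(x)`: the point `{x}` if every `A_k ≡ 0` or `γ > 2`, and the
closed unit ball `B̄₁(x)` otherwise. -/
def Dset {n m : ℕ} (S : Setting n (m + 1)) (x : Euc n) : Set (Euc n) :=
  if degenCase S then {x} else Metric.closedBall x 1

/-- `mm` solves the metric system at level `μ`, excised at `x`, with boundary data
`w(·) − w(x)` and the natural growth conditions at infinity. -/
def IsMetricSoln {n m : ℕ} (S : Setting n (m + 1)) (p : Euc n) (r μ : ℝ) (ω : S.Ω)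
    (x : Euc n) (wb : Fin (m + 1) → Euc n → ℝ) (mm : Fin (m + 1) → Euc n → ℝ) : Prop :=
  (∀ k, Continuous (mm k)) ∧
  IsViscSolnOn (statOp S p r μ ω) (Dset S x)ᶜ mm ∧
  (∀ y ∈ frontier (Dset S x), ∀ k, mm k y = wb k y - wb k x) ∧
  (∀ k, SublinearBelow (mm k)) ∧ (∀ k, SublinearAbove (mm k))

/-- `M k y x = m_{k,μ}(y, x, ω)`, the metric solution excised at `x`, extended (in the case
`A_k ≠ 0` for some `k` and `γ ≤ 2`) by `w(y) − w(x)` for `|x − y| < 1`. -/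
def IsExtMetric {n m : ℕ} (S : Setting n (m + 1)) (p : Euc n) (r μ : ℝ) (ω : S.Ω)
    (wb : Fin (m + 1) → Euc n → ℝ) (M : Fin (m + 1) → Euc n → Euc n → ℝ) : Prop :=
  (∀ x : Euc n, IsMetricSoln S p r μ ω x wb fun k y => M k y x) ∧
  (¬ degenCase S → ∀ k x y, ‖x - y‖ < 1 → M k y x = wb k y - wb k x)

/-- Scalar first-order viscosity subsolution on `U` of `G(y, u, Du) = 0`. -/
def IsViscSubOn1 {n : ℕ} (G : Euc n → ℝ → Euc n → ℝ) (U : Set (Euc n))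
    (u : Euc n → ℝ) : Prop :=
  ∀ φ : Euc n → ℝ, ContDiff ℝ 2 φ → ∀ y₀ ∈ U,
    IsLocalMaxOn (fun y => u y - φ y) U y₀ → G y₀ (u y₀) (gradient φ y₀) ≤ 0

/-- Scalar first-order viscosity supersolution on `U` of `G(y, u, Du) = 0`. -/
def IsViscSupOn1 {n : ℕ} (G : Euc n → ℝ → Euc n → ℝ) (U : Set (Euc n))
    (u : Euc n → ℝ) : Prop :=
  ∀ φ : Euc n → ℝ, ContDiff ℝ 2 φ → ∀ y₀ ∈ U,
    IsLocalMinOn (fun y => u y - φ y) U y₀ → 0 ≤ G y₀ (u y₀) (gradient φ y₀)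

/-- `M` solves the effective metric problem `H̄(p + DM, r) = μ` on `ℝⁿ ∖ {0}`, `M(0) = 0`,
subject to the growth conditions `0 ≤ liminf M/|y| ≤ limsup M/|y| < ∞`. -/
def IsEffMetricSoln {n : ℕ} (Hbar : Euc n → ℝ → ℝ) (p : Euc n) (r μ : ℝ)
    (M : Euc n → ℝ) : Prop :=
  Continuous M ∧
  IsViscSubOn1 (fun _y _val q => Hbar (p + q) r - μ) {(0 : Euc n)}ᶜ M ∧
  IsViscSupOn1 (fun _y _val q => Hbar (p + q) r - μ) {(0 : Euc n)}ᶜ M ∧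
  M 0 = 0 ∧ SublinearBelow M ∧ SublinearAbove M

/-- Spatial gradient of a space-time test function. -/
def gradX {n : ℕ} (φ : Euc n × ℝ → ℝ) (x : Euc n) (t : ℝ) : Euc n :=
  gradient (fun x' => φ (x', t)) x

/-- Spatial Hessian of a space-time test function. -/
def hessX {n : ℕ} (φ : Euc n × ℝ → ℝ) (x : Euc n) (t : ℝ) : Matrix (Fin n) (Fin n) ℝ :=
  hess (fun x' => φ (x', t)) x

/-- Time derivative of a space-time test function. -/
def derT {n : ℕ} (φ : Euc n × ℝ → ℝ) (x : Euc n) (t : ℝ) : ℝ :=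
  deriv (fun t' => φ (x, t')) t

/-- Parabolic viscosity subsolution on `U ⊆ ℝⁿ × ℝ` of the system
`G_k(x, t, u(x,t), ∂_t u_k, Du_k, D²u_k) = 0`. -/
def IsParSubOn {n m : ℕ}
    (G : Fin m → Euc n → ℝ → (Fin m → ℝ) → ℝ → Euc n → Matrix (Fin n) (Fin n) ℝ → ℝ)
    (U : Set (Euc n × ℝ)) (u : Fin m → Euc n × ℝ → ℝ) : Prop :=
  ∀ k : Fin m, ∀ φ : Euc n × ℝ → ℝ, ContDiff ℝ 2 φ → ∀ z ∈ U,
    IsLocalMaxOn (fun w => u k w - φ w) U z →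
      G k z.1 z.2 (fun j => u j z) (derT φ z.1 z.2) (gradX φ z.1 z.2) (hessX φ z.1 z.2) ≤ 0

/-- Parabolic viscosity supersolution on `U ⊆ ℝⁿ × ℝ`. -/
def IsParSupOn {n m : ℕ}
    (G : Fin m → Euc n → ℝ → (Fin m → ℝ) → ℝ → Euc n → Matrix (Fin n) (Fin n) ℝ → ℝ)
    (U : Set (Euc n × ℝ)) (u : Fin m → Euc n × ℝ → ℝ) : Prop :=
  ∀ k : Fin m, ∀ φ : Euc n × ℝ → ℝ, ContDiff ℝ 2 φ → ∀ z ∈ U,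
    IsLocalMinOn (fun w => u k w - φ w) U z →
      0 ≤ G k z.1 z.2 (fun j => u j z) (derT φ z.1 z.2) (gradX φ z.1 z.2) (hessX φ z.1 z.2)

/-- Scalar first-order parabolic viscosity subsolution on `U` of `G(x, t, u, u_t, Du) = 0`. -/
def IsParSubOn1 {n : ℕ} (G : Euc n → ℝ → ℝ → ℝ → Euc n → ℝ)
    (U : Set (Euc n × ℝ)) (u : Euc n × ℝ → ℝ) : Prop :=
  ∀ φ : Euc n × ℝ → ℝ, ContDiff ℝ 2 φ → ∀ z ∈ U,
    IsLocalMaxOn (fun w => u w - φ w) U z →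
      G z.1 z.2 (u z) (derT φ z.1 z.2) (gradX φ z.1 z.2) ≤ 0

/-- Scalar first-order parabolic viscosity supersolution on `U`. -/
def IsParSupOn1 {n : ℕ} (G : Euc n → ℝ → ℝ → ℝ → Euc n → ℝ)
    (U : Set (Euc n × ℝ)) (u : Euc n × ℝ → ℝ) : Prop :=
  ∀ φ : Euc n × ℝ → ℝ, ContDiff ℝ 2 φ → ∀ z ∈ U,
    IsLocalMinOn (fun w => u w - φ w) U z →
      0 ≤ G z.1 z.2 (u z) (derT φ z.1 z.2) (gradX φ z.1 z.2)

/-- `u` is "the" solution of the effective scalar equation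
`u_t + H̄(Du, u) = 0` on `ℝⁿ × (0,∞)`, `u = u₀` on `ℝⁿ × {0}`: bounded and uniformly
continuous on every strip `ℝⁿ × [0, T)`, a viscosity solution for `t > 0`, attaining the
initial data. -/
def IsEffSoln {n : ℕ} (Hbar : Euc n → ℝ → ℝ) (u₀ : Euc n → ℝ) (u : Euc n × ℝ → ℝ) : Prop :=
  (∀ T : ℝ, 0 < T → (∃ B : ℝ, ∀ x t, t ∈ Set.Ico (0 : ℝ) T → |u (x, t)| ≤ B) ∧
      UniformContinuousOn u (Set.univ ×ˢ Set.Ico (0 : ℝ) T)) ∧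
  IsParSubOn1 (fun _x _t val ut q => ut + Hbar q val) (Set.univ ×ˢ Set.Ioi (0 : ℝ)) u ∧
  IsParSupOn1 (fun _x _t val ut q => ut + Hbar q val) (Set.univ ×ˢ Set.Ioi (0 : ℝ)) u ∧
  ∀ x, u (x, 0) = u₀ x

/-- The operator of the oscillating ε-system:
`u_t − ε tr(A_k(x/ε,ω) D²u_k) + H_k(Du_k, u, (u_k − u_j)/ε, x/ε, ω) = 0`. -/
def epsOp {n m : ℕ} (S : Setting n (m + 1)) (ε : ℝ) (ω : S.Ω) :
    Fin (m + 1) → Euc n → ℝ → (Fin (m + 1) → ℝ) → ℝ → Euc n →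
      Matrix (Fin n) (Fin n) ℝ → ℝ :=
  fun k x _t vals ut q X =>
    ut - ε * (S.A k (ε⁻¹ • x) ω * X).trace +
      S.H k q vals (fun j => (vals k - vals j) / ε) (ε⁻¹ • x) ω

/-- `u` is the (bounded, continuous) viscosity solution of the ε-system with initial
datum `u₀`. -/
def IsEpsSoln {n m : ℕ} (S : Setting n (m + 1)) (ε : ℝ) (ω : S.Ω)
    (u₀ : Fin (m + 1) → Euc n → ℝ) (u : Fin (m + 1) → Euc n × ℝ → ℝ) : Prop :=
  (∀ k, Continuous (u k)) ∧
  (∀ T : ℝ, 0 < T → ∃ B : ℝ, ∀ k x t, t ∈ Set.Icc (0 : ℝ) T → |u k (x, t)| ≤ B) ∧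
  IsParSubOn (epsOp S ε ω) (Set.univ ×ˢ Set.Ioi (0 : ℝ)) u ∧
  IsParSupOn (epsOp S ε ω) (Set.univ ×ˢ Set.Ioi (0 : ℝ)) u ∧
  ∀ k x, u k (x, 0) = u₀ k x

section

/-- A function on `[0,1]` whose increments are bounded below to first order by `-ε` does not
decrease by more than `ε`. -/
theorem sub_le_of_forall_increment {f : ℝ → ℝ} {ε C : ℝ}
    (h : ∀ t ∈ Set.Icc (0 : ℝ) 1, ∀ t' ∈ Set.Icc (0 : ℝ) 1,
      -(ε * |t' - t| + C * (t' - t) ^ 2) ≤ f t' - f t) :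
    |f 1 - f 0| ≤ ε := by
  have step : ∀ g : ℝ → ℝ, (∀ t ∈ Set.Icc (0 : ℝ) 1, ∀ t' ∈ Set.Icc (0 : ℝ) 1,
      -(ε * |t' - t| + C * (t' - t) ^ 2) ≤ g t' - g t) → g 0 - g 1 ≤ ε := by
    intro g hg
    have bound : ∀ N : ℕ, g 0 - g 1 ≤ ε + C * (1 / ((N : ℝ) + 1)) := by
      intro N
      have hN : (0 : ℝ) < (N : ℝ) + 1 := by positivity
      have ind : ∀ i : ℕ, i ≤ N + 1 →
          g 0 - i * (ε / (N + 1) + C / (N + 1) ^ 2) ≤ g (i / (N + 1)) := by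
        intro i
        induction i with
        | zero => intro _; simp
        | succ i ih =>
          intro hi
          have hi' : (i : ℝ) + 1 ≤ N + 1 := by exact_mod_cast hi
          have h1 := ih (by omega)
          have h2 := hg (i / (N + 1))
            ⟨by positivity, by rw [div_le_one hN]; linarith⟩
            (((i + 1 : ℕ) : ℝ) / (N + 1))
            ⟨by positivity, by rw [div_le_one hN]; push_cast; linarith⟩
          have h3 : ((i + 1 : ℕ) : ℝ) / (N + 1) - i / (N + 1) = 1 / (N + 1) := by
            push_cast; field_simp; ring
          rw [h3, abs_of_pos (by positivity)] at h2
          have h4 : ε * (1 / ((N : ℝ) + 1)) + C * (1 / ((N : ℝ) + 1)) ^ 2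
              = ε / (N + 1) + C / (N + 1) ^ 2 := by
            field_simp
          rw [h4] at h2
          push_cast at h2 ⊢
          linarith
      have h1 := ind (N + 1) le_rfl
      have h2 : (((N + 1 : ℕ) : ℝ)) / (N + 1) = 1 := by
        push_cast; field_simp
      have h3 : (((N + 1 : ℕ) : ℝ)) * (ε / (N + 1) + C / (N + 1) ^ 2)
          = ε + C * (1 / ((N : ℝ) + 1)) := by
        push_cast; field_simp
      rw [h2, h3] at h1
      linarith
    have lim : Tendsto (fun N : ℕ => ε + C * (1 / ((N : ℝ) + 1))) atTop (𝓝 (ε + C * 0)) :=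
      (tendsto_one_div_add_atTop_nhds_zero_nat.const_mul C).const_add ε
    have := ge_of_tendsto' lim bound
    simpa using this
  rw [abs_le]
  constructor
  · linarith [step f h]
  · have := step (fun t => f (1 - t)) (by
      intro t ht t' ht'
      have := h (1 - t) ⟨by linarith [ht.2], by linarith [ht.1]⟩ (1 - t')
        ⟨by linarith [ht'.2], by linarith [ht'.1]⟩
      have e : 1 - t' - (1 - t) = -(t' - t) := by ring
      rw [e, abs_neg, neg_sq] at this
      exact this)
    simpa using this

variable {F : Type*} [NormedAddCommGroup F] [InnerProductSpace ℝ F]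

theorem norm_le_of_forall_inner_le {v : F} {lam c : ℝ} (hlam : 0 ≤ lam) (hc : 0 ≤ c)
    (h : ∀ e : F, inner ℝ v e ≤ lam / 2 * (‖e‖ ^ 2 + c ^ 2)) : ‖v‖ ≤ lam * c := by
  have key : ∀ s : ℝ, s * ‖v‖ ^ 2 ≤ lam / 2 * (s ^ 2 * ‖v‖ ^ 2 + c ^ 2) := by
    intro s
    have := h (s • v)
    rwa [real_inner_smul_right, real_inner_self_eq_norm_sq, norm_smul, mul_pow, Real.norm_eq_abs,
      sq_abs] at this
  rcases hc.eq_or_lt with rfl | hc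
  · have := key (1 / (lam + 1))
    have h1 : lam / 2 * ((1 / (lam + 1)) ^ 2 * ‖v‖ ^ 2 + 0 ^ 2)
        = 1 / (lam + 1) * (lam / (2 * (lam + 1)) * ‖v‖ ^ 2) := by
      field_simp; ring
    rw [h1] at this
    have h2 := le_of_mul_le_mul_left this (by positivity)
    have h3 : lam / (2 * (lam + 1)) ≤ 1 / 2 := by
      rw [div_le_div_iff₀ (by positivity) (by norm_num)]; linarith
    have h4 : ‖v‖ ^ 2 ≤ 0 := by nlinarith [sq_nonneg ‖v‖]
    have h5 : ‖v‖ = 0 := by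
      have := le_antisymm h4 (sq_nonneg _)
      exact pow_eq_zero_iff (two_ne_zero) |>.1 this
    simp [h5]
  · rcases (norm_nonneg v).eq_or_lt with h0 | h0
    · rw [← h0]; positivity
    have := key (c / ‖v‖)
    have h1 : c / ‖v‖ * ‖v‖ ^ 2 = c * ‖v‖ := by field_simp
    have h2 : (c / ‖v‖) ^ 2 * ‖v‖ ^ 2 = c ^ 2 := by field_simp
    rw [h1, h2] at this
    nlinarith

/-- Second-order expansion from a first-order expansion of a semiconvexity subgradient. -/
theorem abs_sub_quadratic_le_of_subgradient {W : F → ℝ} {m : F → F} {lam ε r : ℝ} {z p : F}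
    {S : F →L[ℝ] F}
    (hm : ∀ x y, W x + inner ℝ (m x) (y - x) - lam / 2 * ‖y - x‖ ^ 2 ≤ W y)
    (hS : ∀ h, ‖h‖ < r → ‖m (z + h) - p - S h‖ ≤ ε * ‖h‖) {h : F} (hε : 0 ≤ ε) (hh : ‖h‖ < r) :
    |W (z + h) - W z - inner ℝ p h - 1 / 2 * inner ℝ (S h) h| ≤ ε * ‖h‖ ^ 2 := by
  let f : ℝ → ℝ := fun t => W (z + t • h) - t * inner ℝ p h - t ^ 2 / 2 * inner ℝ (S h) h
  have key := sub_le_of_forall_increment (f := f) (ε := ε * ‖h‖ ^ 2)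
    (C := lam / 2 * ‖h‖ ^ 2 + 1 / 2 * inner ℝ (S h) h) (by
      intro t ht t' ht'
      have h1 := hm (z + t • h) (z + t' • h)
      have e1 : z + t' • h - (z + t • h) = (t' - t) • h := by module
      rw [e1, real_inner_smul_right, norm_smul, mul_pow, Real.norm_eq_abs, sq_abs] at h1
      have hth : ‖t • h‖ ≤ ‖h‖ := by
        rw [norm_smul, Real.norm_eq_abs, abs_of_nonneg ht.1]
        exact mul_le_of_le_one_left (norm_nonneg _) ht.2
      have h2 := hS (t • h) (hth.trans_lt hh)
      have h3 : |inner ℝ (m (z + t • h) - p - S (t • h)) h| ≤ ε * ‖h‖ ^ 2 := by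
        calc |inner ℝ (m (z + t • h) - p - S (t • h)) h|
            ≤ ‖m (z + t • h) - p - S (t • h)‖ * ‖h‖ := abs_real_inner_le_norm _ _
          _ ≤ (ε * ‖t • h‖) * ‖h‖ := by gcongr
          _ ≤ (ε * ‖h‖) * ‖h‖ := by gcongr
          _ = ε * ‖h‖ ^ 2 := by ring
      rw [map_smul, inner_sub_left, inner_sub_left, real_inner_smul_left] at h3
      have h4 : -(ε * ‖h‖ ^ 2 * |t' - t|) ≤
          (t' - t) * (inner ℝ (m (z + t • h)) h - inner ℝ p h - t * inner ℝ (S h) h) := by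
        have := neg_abs_le
          ((t' - t) * (inner ℝ (m (z + t • h)) h - inner ℝ p h - t * inner ℝ (S h) h))
        rw [abs_mul] at this
        nlinarith [mul_le_mul_of_nonneg_left h3 (abs_nonneg (t' - t))]
      simp only [f]
      nlinarith)
  simp only [f, one_smul, zero_smul, add_zero] at key
  convert key using 2
  ring

theorem exists_leftInverse_of_littleO [FiniteDimensional ℝ F] (T : F →L[ℝ] F) (k : F → F)
    (h : ∀ ε : ℝ, 0 < ε → ∀ᶠ x in 𝓝 (0 : F), ‖x - T (k x)‖ ≤ ε * ‖x‖) :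
    ∃ T' : F →L[ℝ] F, ∀ x, T' (T x) = x := by
  have hsurj : LinearMap.range (T : F →ₗ[ℝ] F) = ⊤ := by
    rw [eq_top_iff]
    intro x _
    have hcl : IsClosed ((LinearMap.range (T : F →ₗ[ℝ] F) : Submodule ℝ F) : Set F) :=
      Submodule.closed_of_finiteDimensional _
    rw [← SetLike.mem_coe, ← hcl.closure_eq, Metric.mem_closure_iff]
    intro ε hε
    have h1 := h (ε / (2 * (‖x‖ + 1))) (by positivity)
    obtain ⟨r, hr, hball⟩ := Metric.eventually_nhds_iff.1 h1
    set t : ℝ := r / (2 * (‖x‖ + 1)) with ht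
    have htpos : 0 < t := by positivity
    have h2 := @hball (t • x) (by
      rw [dist_zero_right, norm_smul, Real.norm_eq_abs, abs_of_pos htpos, ht]
      rw [div_mul_eq_mul_div, div_lt_iff₀ (by positivity)]
      nlinarith [norm_nonneg x])
    refine ⟨T (t⁻¹ • k (t • x)), ⟨t⁻¹ • k (t • x), rfl⟩, ?_⟩
    have e : x - T (t⁻¹ • k (t • x)) = t⁻¹ • (t • x - T (k (t • x))) := by
      rw [map_smul, smul_sub, smul_smul, inv_mul_cancel₀ htpos.ne', one_smul]
    rw [dist_eq_norm, e, norm_smul, Real.norm_eq_abs, abs_of_pos (inv_pos.2 htpos)]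
    rw [norm_smul, Real.norm_eq_abs, abs_of_pos htpos] at h2
    calc t⁻¹ * ‖t • x - T (k (t • x))‖ ≤ t⁻¹ * (ε / (2 * (‖x‖ + 1)) * (t * ‖x‖)) := by gcongr
      _ = ε * (‖x‖ / (2 * (‖x‖ + 1))) := by field_simp
      _ < ε * 1 := by
        gcongr
        rw [div_lt_one (by positivity)]
        linarith [norm_nonneg x]
      _ = ε := mul_one _
  have hker := LinearMap.ker_eq_bot_iff_range_eq_top.2 hsurj
  obtain ⟨g, hg⟩ := LinearMap.exists_leftInverse_of_injective _ hker
  refine ⟨LinearMap.toContinuousLinearMap g, fun x => ?_⟩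
  exact congrArg (fun f : F →ₗ[ℝ] F => f x) hg

open scoped NNReal in
theorem exists_ball_notMem_image_not_differentiable [FiniteDimensional ℝ F] {J Θ : F → F}
    {K K' : ℝ≥0} (hJ : LipschitzWith K J) (hΘ : LipschitzWith K' Θ) {ρ : ℝ} (hρ : 0 < ρ) :
    ∃ p : F, ‖p‖ < ρ ∧ ∀ y, Θ y = p → DifferentiableAt ℝ J y := by
  borelize F
  let μ : Measure F := μHE[Module.finrank ℝ F]
  have h1 : μ {y | ¬ DifferentiableAt ℝ J y} = 0 := ae_iff.1 (hJ.ae_differentiableAt (μ := μ))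
  have h2 : μ (Θ '' {y | ¬ DifferentiableAt ℝ J y}) = 0 := by
    have hc := Measure.addHaarScalarFactor_volume_hausdorffMeasure_ne_zero (Module.finrank ℝ F)
    have hH : μH[Module.finrank ℝ F] {y | ¬ DifferentiableAt ℝ J y} = 0 := by
      have h1' := h1
      simp only [μ, Measure.euclideanHausdorffMeasure_def, Measure.smul_apply] at h1'
      rw [ENNReal.smul_def, smul_eq_mul, mul_eq_zero] at h1'
      rcases h1' with h1' | h1'
      · exact absurd (by exact_mod_cast h1') hc
      · exact h1'
    have hH2 := hΘ.hausdorffMeasure_image_le (d := (Module.finrank ℝ F : ℝ)) (by positivity)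
      {y | ¬ DifferentiableAt ℝ J y}
    rw [hH, mul_zero, nonpos_iff_eq_zero] at hH2
    simp only [μ, Measure.euclideanHausdorffMeasure_def, Measure.smul_apply]
    rw [hH2, smul_zero]
  have h3 : 0 < μ (Metric.ball 0 ρ) := Metric.measure_ball_pos μ 0 hρ
  by_contra hcon
  push Not at hcon
  have h4 : Metric.ball 0 ρ ⊆ Θ '' {y | ¬ DifferentiableAt ℝ J y} := by
    intro p hp
    obtain ⟨y, hy, hy'⟩ := hcon p (by simpa using hp)
    exact ⟨y, hy', hy⟩
  exact absurd (measure_mono_null h4 h2) h3.ne'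

/-- Jensen's lemma combined with Alexandrov's theorem: after an arbitrarily small linear
perturbation, a semiconvex function has a second-order expansion at each of its maximum points. -/
theorem exists_perturbation_forall_max_expansion [FiniteDimensional ℝ F] {W : F → ℝ} {lam : ℝ}
    (hlam : 0 ≤ lam)
    (hW : ∀ z, ∃ m : F, ∀ z', W z + inner ℝ m (z' - z) - lam / 2 * ‖z' - z‖ ^ 2 ≤ W z')
    {ρ : ℝ} (hρ : 0 < ρ) :
    ∃ p : F, ‖p‖ < ρ ∧ ∀ z, (∀ z', W z' - inner ℝ p z' ≤ W z - inner ℝ p z) →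
      ∃ S : F →L[ℝ] F, ∀ ε : ℝ, 0 < ε → ∀ᶠ h in 𝓝 (0 : F),
        |W (z + h) - W z - inner ℝ p h - 1 / 2 * inner ℝ (S h) h| ≤ ε * ‖h‖ ^ 2 := by
  choose m hm using hW
  let Y : F → F := fun z => (1 + lam) • z + m z
  have hmono : ∀ z₁ z₂, -lam * ‖z₁ - z₂‖ ^ 2 ≤ inner ℝ (m z₁ - m z₂) (z₁ - z₂) := by
    intro z₁ z₂
    have h1 := hm z₁ z₂
    have h2 := hm z₂ z₁
    rw [← neg_sub z₁ z₂, inner_neg_right, norm_neg] at h1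
    rw [inner_sub_left]
    linarith
  have hY : ∀ z₁ z₂, ‖z₁ - z₂‖ ≤ ‖Y z₁ - Y z₂‖ := by
    intro z₁ z₂
    have h1 : ‖z₁ - z₂‖ ^ 2 ≤ inner ℝ (Y z₁ - Y z₂) (z₁ - z₂) := by
      have e : Y z₁ - Y z₂ = (1 + lam) • (z₁ - z₂) + (m z₁ - m z₂) := by
        simp only [Y]; module
      rw [e, inner_add_left, real_inner_smul_left, real_inner_self_eq_norm_sq]
      linarith [hmono z₁ z₂]
    have h2 := h1.trans (real_inner_le_norm _ _)
    rcases (norm_nonneg (z₁ - z₂)).eq_or_lt with h0 | h0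
    · rw [← h0]; exact norm_nonneg _
    · rw [pow_two] at h2
      exact le_of_mul_le_mul_right h2 h0
  let J₀ : F → F := Function.invFun Y
  have hYinj : Function.Injective Y := by
    intro z₁ z₂ h
    have := hY z₁ z₂
    rw [h, sub_self, norm_zero] at this
    exact sub_eq_zero.1 (norm_le_zero_iff.1 this)
  have hJ₀ : ∀ z, J₀ (Y z) = z := Function.leftInverse_invFun hYinj
  have hJ₀L : LipschitzOnWith 1 J₀ (Set.range Y) := by
    refine LipschitzOnWith.of_dist_le_mul ?_
    rintro _ ⟨z₁, rfl⟩ _ ⟨z₂, rfl⟩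
    rw [hJ₀, hJ₀, dist_eq_norm, dist_eq_norm, NNReal.coe_one, one_mul]
    exact hY z₁ z₂
  obtain ⟨J, hJL, hJ⟩ := hJ₀L.extend_finite_dimension
  have hJY : ∀ z, J (Y z) = z := fun z => by rw [← hJ (Set.mem_range_self z), hJ₀]
  let Θ : F → F := fun y => y - (1 + lam) • J y
  have hΘL := LipschitzWith.id.sub ((lipschitzWith_smul (1 + lam)).comp hJL)
  obtain ⟨p, hpρ, hp⟩ := exists_ball_notMem_image_not_differentiable (Θ := Θ) hJL hΘL hρ
  refine ⟨p, hpρ, fun z hz => ?_⟩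
  have hmz : m z = p := by
    have : ‖m z - p‖ ≤ lam * 0 := norm_le_of_forall_inner_le hlam le_rfl fun e => by
      have h1 := hm z (z + e)
      have h2 := hz (z + e)
      rw [add_sub_cancel_left] at h1
      rw [inner_add_right] at h2
      rw [inner_sub_left]
      linarith
    rw [mul_zero] at this
    exact sub_eq_zero.1 (norm_le_zero_iff.1 this)
  have hupper : ∀ h, ‖m (z + h) - p‖ ≤ lam * ‖h‖ := by
    intro h
    refine norm_le_of_forall_inner_le hlam (norm_nonneg _) fun e => ?_
    have h1 := hm (z + h) (z + h + e)
    have h2 := hz (z + h + e)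
    have h3 := hm z (z + h)
    rw [add_sub_cancel_left] at h1 h3
    rw [inner_add_right, inner_add_right] at h2
    rw [hmz] at h3
    rw [inner_sub_left]
    linarith
  let k : F → F := fun h => (1 + lam) • h + (m (z + h) - p)
  have hk : ∀ h, Y (z + h) = Y z + k h := by
    intro h
    simp only [Y, k, hmz]; module
  have hknorm : ∀ h, ‖k h‖ ≤ (1 + 2 * lam) * ‖h‖ := by
    intro h
    calc ‖k h‖ ≤ ‖(1 + lam) • h‖ + ‖m (z + h) - p‖ := norm_add_le _ _
      _ ≤ (1 + lam) * ‖h‖ + lam * ‖h‖ := by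
        gcongr
        · rw [norm_smul, Real.norm_eq_abs, abs_of_nonneg (by linarith)]
        · exact hupper h
      _ = (1 + 2 * lam) * ‖h‖ := by ring
  have hdiff : DifferentiableAt ℝ J (Y z) := hp (Y z) (by
    change Y z - (1 + lam) • J (Y z) = p
    rw [hJY]
    simp only [Y, hmz]; module)
  let T := fderiv ℝ J (Y z)
  have hT : ∀ ε : ℝ, 0 < ε → ∀ᶠ h in 𝓝 (0 : F), ‖h - T (k h)‖ ≤ ε * ‖h‖ := by
    intro ε hε
    have h1 := hasFDerivAt_iff_isLittleO_nhds_zero.1 hdiff.hasFDerivAt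
    have h2 := (Asymptotics.isLittleO_iff.1 h1) (c := ε / (1 + 2 * lam)) (by positivity)
    have htend : Tendsto k (𝓝 0) (𝓝 0) := by
      refine squeeze_zero_norm hknorm ?_
      have : Tendsto (fun h : F => (1 + 2 * lam) * ‖h‖) (𝓝 0) (𝓝 ((1 + 2 * lam) * ‖(0 : F)‖)) :=
        (continuous_norm.tendsto 0).const_mul _
      simpa using this
    filter_upwards [htend.eventually h2] with h hh
    rw [← hk, hJY, hJY, add_sub_cancel_left] at hh
    calc ‖h - T (k h)‖ ≤ ε / (1 + 2 * lam) * ‖k h‖ := hh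
      _ ≤ ε / (1 + 2 * lam) * ((1 + 2 * lam) * ‖h‖) := by gcongr; exact hknorm h
      _ = ε * ‖h‖ := by field_simp
  obtain ⟨T', hT'⟩ := exists_leftInverse_of_littleO T k hT
  refine ⟨T' - (1 + lam) • ContinuousLinearMap.id ℝ F, fun ε hε => ?_⟩
  obtain ⟨r, hr, hball⟩ := Metric.eventually_nhds_iff.1
    (hT (ε / (‖T'‖ + 1)) (by positivity))
  filter_upwards [Metric.ball_mem_nhds (0 : F) hr] with h hh
  refine abs_sub_quadratic_le_of_subgradient hm (r := r) (fun x hx => ?_) hε.le (by simpa using hh)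
  have h1 := hball (by simpa using hx)
  have e : m (z + x) - p - (T' - (1 + lam) • ContinuousLinearMap.id ℝ F) x
      = -T' (x - T (k x)) := by
    rw [map_sub, hT']
    simp only [_root_.sub_apply, _root_.smul_apply,
      ContinuousLinearMap.id_apply, k]
    module
  rw [e, norm_neg]
  calc ‖T' (x - T (k x))‖ ≤ ‖T'‖ * ‖x - T (k x)‖ := T'.le_opNorm _
    _ ≤ (‖T'‖ + 1) * (ε / (‖T'‖ + 1) * ‖x‖) := by gcongr; linarith
    _ = ε * ‖x‖ := by field_simp

end

section

theorem exists_max_of_le_linear {E : Type*} [NormedAddCommGroup E] [ProperSpace E] {g : E → ℝ}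
    (hg : Continuous g) {C c : ℝ} (hc : 0 < c) (h : ∀ y, g y ≤ C - c * ‖y‖) :
    ∃ x, ∀ y, g y ≤ g x := by
  refine hg.exists_forall_ge (tendsto_atBot_mono h ?_)
  have h1 := (tendsto_norm_cocompact_atTop (E := E)).const_mul_atTop hc
  exact tendsto_atBot_add_const_left _ C (tendsto_neg_atTop_atBot.comp h1)

theorem exists_max_of_le_quadratic {E : Type*} [NormedAddCommGroup E] [ProperSpace E] {g : E → ℝ}
    (hg : Continuous g) {C c ν : ℝ} {z : E} (hc : 0 ≤ c) (hν : 0 < ν)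
    (h : ∀ y, g y ≤ C + c * ‖y‖ - ν * ‖y - z‖ ^ 2) :
    ∃ x, ∀ y, g y ≤ g x := by
  refine exists_max_of_le_linear hg (c := 1) (C := C + (1 + c) * ‖z‖ + (1 + c) ^ 2 / (4 * ν))
    one_pos fun y => (h y).trans ?_
  have h1 : ‖y‖ ≤ ‖y - z‖ + ‖z‖ := by
    simpa using norm_add_le (y - z) z
  have h2 : (1 + c) * ‖y - z‖ ≤ ν * ‖y - z‖ ^ 2 + (1 + c) ^ 2 / (4 * ν) := by
    have : 0 ≤ ν * (‖y - z‖ - (1 + c) / (2 * ν)) ^ 2 := by positivity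
    have e : ν * (‖y - z‖ - (1 + c) / (2 * ν)) ^ 2
        = ν * ‖y - z‖ ^ 2 + (1 + c) ^ 2 / (4 * ν) - (1 + c) * ‖y - z‖ := by
      field_simp; ring
    linarith
  nlinarith

theorem exists_max_index {ι E : Type*} [Finite ι] [Nonempty ι] {g : ι → E → ℝ}
    (h : ∀ k, ∃ x, ∀ y, g k y ≤ g k x) : ∃ k x, ∀ k' y, g k' y ≤ g k x := by
  choose x hx using h
  obtain ⟨k, hk⟩ := Finite.exists_max fun k => g k (x k)
  exact ⟨k, x k, fun k' y => (hx k' y).trans (hk k')⟩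

variable {n : ℕ}

/-- Existence of the sup-convolution of a bounded Lipschitz function, with its maximizers. -/
theorem exists_supConvolution {u : Euc n → ℝ} {B L ϵ : ℝ} (hB : ∀ x, |u x| ≤ B)
    (hL : ∀ x y, |u x - u y| ≤ L * ‖x - y‖) (hϵ : 0 < ϵ) :
    ∃ (U : Euc n → ℝ) (ξ : Euc n → Euc n),
      (∀ x, U x = u (ξ x) - ‖x - ξ x‖ ^ 2 / (2 * ϵ)) ∧
      (∀ x y, u y - ‖x - y‖ ^ 2 / (2 * ϵ) ≤ U x) := by
  have hcont : Continuous u := by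
    refine (LipschitzWith.of_dist_le_mul (K := L.toNNReal) fun x y => ?_).continuous
    rw [Real.dist_eq, dist_eq_norm]
    exact (hL x y).trans (by gcongr; exact Real.le_coe_toNNReal L)
  have h : ∀ x, ∃ ξ, ∀ y, u y - ‖x - y‖ ^ 2 / (2 * ϵ) ≤ u ξ - ‖x - ξ‖ ^ 2 / (2 * ϵ) := by
    intro x
    refine exists_max_of_le_quadratic (g := fun y => u y - ‖x - y‖ ^ 2 / (2 * ϵ))
      (by fun_prop) (C := B) (c := 0) (ν := 1 / (2 * ϵ)) (z := x) le_rfl (by positivity) fun y => ?_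
    rw [norm_sub_rev y x, one_div_mul_eq_div]
    linarith [(abs_le.1 (hB y)).2]
  choose ξ hξ using h
  exact ⟨fun x => u (ξ x) - ‖x - ξ x‖ ^ 2 / (2 * ϵ), ξ, fun _ => rfl, hξ⟩

section SupConvolution

variable {u U : Euc n → ℝ} {ξ : Euc n → Euc n} {L ϵ : ℝ}

theorem supConvolution_dist_le (hL : ∀ x y, |u x - u y| ≤ L * ‖x - y‖) (hL0 : 0 ≤ L) (hϵ : 0 < ϵ)
    (hU : ∀ x, U x = u (ξ x) - ‖x - ξ x‖ ^ 2 / (2 * ϵ))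
    (hle : ∀ x y, u y - ‖x - y‖ ^ 2 / (2 * ϵ) ≤ U x) (x : Euc n) : ‖x - ξ x‖ ≤ 2 * L * ϵ := by
  have h1 := hle x x
  rw [hU, sub_self, norm_zero] at h1
  have h2 := (abs_le.1 (hL x (ξ x))).1
  have h3 : ‖x - ξ x‖ ^ 2 / (2 * ϵ) ≤ L * ‖x - ξ x‖ := by
    norm_num at h1
    linarith
  rw [div_le_iff₀ (by positivity)] at h3
  by_contra hcon
  push Not at hcon
  have : 0 < ‖x - ξ x‖ := lt_of_le_of_lt (by positivity) hcon
  nlinarith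

theorem supConvolution_le (hL : ∀ x y, |u x - u y| ≤ L * ‖x - y‖) (hϵ : 0 < ϵ)
    (hU : ∀ x, U x = u (ξ x) - ‖x - ξ x‖ ^ 2 / (2 * ϵ)) (x : Euc n) :
    U x ≤ u x + L ^ 2 * ϵ / 2 := by
  rw [hU]
  have h2 := (abs_le.1 (hL x (ξ x))).1
  have h3 : 0 ≤ (‖x - ξ x‖ - L * ϵ) ^ 2 / (2 * ϵ) := by positivity
  have e : (‖x - ξ x‖ - L * ϵ) ^ 2 / (2 * ϵ)
      = ‖x - ξ x‖ ^ 2 / (2 * ϵ) - L * ‖x - ξ x‖ + L ^ 2 * ϵ / 2 := by field_simp; ring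
  linarith

theorem le_supConvolution (hle : ∀ x y, u y - ‖x - y‖ ^ 2 / (2 * ϵ) ≤ U x) (x : Euc n) :
    u x ≤ U x := by
  simpa using hle x x

theorem sub_le_supConvolution_sub (hU : ∀ x, U x = u (ξ x) - ‖x - ξ x‖ ^ 2 / (2 * ϵ))
    (hle : ∀ x y, u y - ‖x - y‖ ^ 2 / (2 * ϵ) ≤ U x) (x h : Euc n) :
    u (ξ x + h) - u (ξ x) ≤ U (x + h) - U x := by
  have h1 := hle (x + h) (ξ x + h)
  rw [add_sub_add_right_eq_sub] at h1
  rw [hU x]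
  linarith

theorem supConvolution_lipschitz (hL : ∀ x y, |u x - u y| ≤ L * ‖x - y‖)
    (hU : ∀ x, U x = u (ξ x) - ‖x - ξ x‖ ^ 2 / (2 * ϵ))
    (hle : ∀ x y, u y - ‖x - y‖ ^ 2 / (2 * ϵ) ≤ U x) : Continuous U := by
  refine (LipschitzWith.of_le_add_mul L.toNNReal fun x y => ?_).continuous
  have h1 := sub_le_supConvolution_sub hU hle x (y - x)
  rw [add_sub_cancel] at h1
  have h2 := (abs_le.1 (hL (ξ x + (y - x)) (ξ x))).1
  rw [add_sub_cancel_left] at h2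
  have h3 : L * ‖y - x‖ ≤ L.toNNReal * dist x y := by
    rw [dist_eq_norm, norm_sub_rev]
    gcongr
    exact Real.le_coe_toNNReal L
  linarith

theorem supConvolution_semiconvex (hU : ∀ x, U x = u (ξ x) - ‖x - ξ x‖ ^ 2 / (2 * ϵ))
    (hle : ∀ x y, u y - ‖x - y‖ ^ 2 / (2 * ϵ) ≤ U x) (x : Euc n) :
    ∃ m : Euc n, ∀ x', U x + inner ℝ m (x' - x) - (1 / ϵ) / 2 * ‖x' - x‖ ^ 2 ≤ U x' := by
  refine ⟨-(1 / ϵ) • (x - ξ x), fun x' => ?_⟩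
  have h1 := hle x' (ξ x)
  have e : x' - ξ x = (x - ξ x) + (x' - x) := by abel
  rw [e, norm_add_sq_real] at h1
  rw [hU x, real_inner_smul_left]
  have e2 : (‖x - ξ x‖ ^ 2 + 2 * inner ℝ (x - ξ x) (x' - x) + ‖x' - x‖ ^ 2) / (2 * ϵ)
      = ‖x - ξ x‖ ^ 2 / (2 * ϵ) + 1 / ϵ * inner ℝ (x - ξ x) (x' - x)
        + (1 / ϵ) / 2 * ‖x' - x‖ ^ 2 := by
    ring
  rw [e2] at h1
  linarith

end SupConvolution

/-- The trace `tr(M Mᵗ T)` written through the columns of `M`. -/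
def columnTrace (M : Matrix (Fin n) (Fin n) ℝ) (T : Euc n →L[ℝ] Euc n) : ℝ :=
  ∑ l, inner ℝ (T (WithLp.toLp 2 fun i => M i l)) (WithLp.toLp 2 fun i => M i l)

/-- The quadratic polynomial with gradient `q` and second derivative the symmetric part of `T`
at `ξ`. -/
def quadPoly (ξ q : Euc n) (T : Euc n →L[ℝ] Euc n) (x : Euc n) : ℝ :=
  inner ℝ q (x - ξ) + 1 / 2 * inner ℝ (T (x - ξ)) (x - ξ)

theorem contDiff_quadPoly (ξ q : Euc n) (T : Euc n →L[ℝ] Euc n) :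
    ContDiff ℝ 2 (quadPoly ξ q T) := by
  unfold quadPoly
  have h1 : ContDiff ℝ 2 fun x : Euc n => x - ξ := contDiff_id.sub contDiff_const
  have h2 : ContDiff ℝ 2 fun x : Euc n => T (x - ξ) := T.contDiff.comp h1
  exact (contDiff_const.inner ℝ h1).add (contDiff_const.mul (h2.inner ℝ h1))

theorem fderiv_quadPoly (ξ q : Euc n) (T : Euc n →L[ℝ] Euc n) (x v : Euc n) :
    fderiv ℝ (quadPoly ξ q T) x v =
      inner ℝ q v + 1 / 2 * (inner ℝ (T (x - ξ)) v + inner ℝ (T v) (x - ξ)) := by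
  have h1 : HasFDerivAt (fun x : Euc n => x - ξ) (ContinuousLinearMap.id ℝ (Euc n)) x :=
    (hasFDerivAt_id x).sub_const ξ
  have h2 : HasFDerivAt (fun x : Euc n => T (x - ξ)) (T.comp (ContinuousLinearMap.id ℝ _)) x :=
    T.hasFDerivAt.comp x h1
  have h3 := ((innerSL ℝ q).hasFDerivAt.comp x h1).add ((h2.inner ℝ h1).const_mul (1 / 2 : ℝ))
  have h4 : HasFDerivAt (quadPoly ξ q T) _ x := h3
  rw [h4.fderiv]
  simp

theorem gradient_quadPoly (ξ q : Euc n) (T : Euc n →L[ℝ] Euc n) :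
    gradient (quadPoly ξ q T) ξ = q := by
  refine ext_inner_right ℝ fun v => ?_
  rw [gradient, InnerProductSpace.toDual_symm_apply, fderiv_quadPoly]
  simp

theorem hess_quadPoly (ξ q : Euc n) (T : Euc n →L[ℝ] Euc n) (i j : Fin n) :
    hess (quadPoly ξ q T) ξ i j =
      1 / 2 * (inner ℝ (T (EuclideanSpace.single i 1)) (EuclideanSpace.single j 1) +
        inner ℝ (T (EuclideanSpace.single j 1)) (EuclideanSpace.single i 1)) := by
  rw [hess, iteratedFDeriv_two_apply]
  have hd : DifferentiableAt ℝ (fderiv ℝ (quadPoly ξ q T)) ξ :=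
    ((contDiff_quadPoly ξ q T).fderiv_right (m := 1) (by norm_num)).differentiable (by norm_num) ξ
  have h1 : HasFDerivAt (fun x : Euc n => x - ξ) (ContinuousLinearMap.id ℝ (Euc n)) ξ :=
    (hasFDerivAt_id ξ).sub_const ξ
  have h2 : HasFDerivAt (fun x : Euc n => T (x - ξ)) (T.comp (ContinuousLinearMap.id ℝ _)) ξ :=
    T.hasFDerivAt.comp ξ h1
  have h3 : ∀ u v : Euc n, fderiv ℝ (fderiv ℝ (quadPoly ξ q T)) ξ u v
      = 1 / 2 * (inner ℝ (T u) v + inner ℝ (T v) u) := by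
    intro u v
    have e1 : fderiv ℝ (fun x => fderiv ℝ (quadPoly ξ q T) x v) ξ u
        = fderiv ℝ (fderiv ℝ (quadPoly ξ q T)) ξ u v := by
      rw [fderiv_clm_apply hd (differentiableAt_const v)]
      simp
    rw [← e1]
    simp only [fderiv_quadPoly]
    have h4 := (((h2.inner ℝ (hasFDerivAt_const v ξ)).add
      ((hasFDerivAt_const (T v) ξ).inner ℝ h1)).const_mul (1 / 2 : ℝ)).const_add (inner ℝ q v)
    have h5 : HasFDerivAt (fun x => inner ℝ q v +
      1 / 2 * (inner ℝ (T (x - ξ)) v + inner ℝ (T v) (x - ξ))) _ ξ := h4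
    rw [h5.fderiv]
    simp [mul_add]
  exact h3 _ _

theorem trace_mul_hess_quadPoly (M : Matrix (Fin n) (Fin n) ℝ) (ξ q : Euc n)
    (T : Euc n →L[ℝ] Euc n) :
    (M * Mᵀ * hess (quadPoly ξ q T) ξ).trace = columnTrace M T := by
  have hcol : ∀ l, (WithLp.toLp 2 fun i => M i l : Euc n) =
      ∑ i, M i l • EuclideanSpace.single i (1 : ℝ) := by
    intro l
    ext j
    simp [Finset.sum_apply, Pi.single_apply]
  have e : ∀ l, inner ℝ (T (WithLp.toLp 2 fun i => M i l)) (WithLp.toLp 2 fun i => M i l) =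
      ∑ i, ∑ j, M i l * M j l *
        inner ℝ (T (EuclideanSpace.single i 1)) (EuclideanSpace.single j (1 : ℝ)) := by
    intro l
    rw [hcol, map_sum, sum_inner]
    refine Finset.sum_congr rfl fun i _ => ?_
    rw [inner_sum]
    refine Finset.sum_congr rfl fun j _ => ?_
    rw [map_smul, real_inner_smul_left, real_inner_smul_right, mul_assoc]
  simp only [columnTrace, e, Matrix.trace, Matrix.diag, Matrix.mul_apply, Matrix.transpose_apply,
    hess_quadPoly, Finset.sum_mul]
  have s1 : ∀ f : Fin n → Fin n → ℝ, ∑ i, ∑ j, 1 / 2 * (f i j + f j i) = ∑ i, ∑ j, f i j := by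
    intro f
    simp only [← Finset.mul_sum, Finset.sum_add_distrib]
    rw [Finset.sum_comm (f := fun i j => f j i)]
    ring
  calc ∑ x, ∑ i, ∑ l, M x l * M i l * (1 / 2 *
        (inner ℝ (T (EuclideanSpace.single i 1)) (EuclideanSpace.single x (1 : ℝ)) +
          inner ℝ (T (EuclideanSpace.single x 1)) (EuclideanSpace.single i (1 : ℝ))))
      = ∑ l, ∑ x, ∑ i, 1 / 2 * (M x l * M i l *
          inner ℝ (T (EuclideanSpace.single x 1)) (EuclideanSpace.single i (1 : ℝ)) +
          M i l * M x l *
          inner ℝ (T (EuclideanSpace.single i 1)) (EuclideanSpace.single x (1 : ℝ))) := by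
        symm
        rw [Finset.sum_comm]
        refine Finset.sum_congr rfl fun x _ => ?_
        rw [Finset.sum_comm]
        refine Finset.sum_congr rfl fun i _ => Finset.sum_congr rfl fun l _ => ?_
        ring
    _ = _ := Finset.sum_congr rfl fun l _ => s1 fun x i => M x l * M i l *
          inner ℝ (T (EuclideanSpace.single x 1)) (EuclideanSpace.single i (1 : ℝ))

end

section

variable {n : ℕ}

/-- The quadratic penalty used in the doubling of variables. -/
def doublingPenalty (α β ν : ℝ) (x₀ y₀ y₁ x y : Euc n) : ℝ :=
  α / 2 * ‖x - y‖ ^ 2 + β / 2 * ‖y - y₁‖ ^ 2 + ν / 2 * (‖x - x₀‖ ^ 2 + ‖y - y₀‖ ^ 2)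

theorem doublingPenalty_add (α β ν : ℝ) (x₀ y₀ y₁ x y σ τ : Euc n) :
    doublingPenalty α β ν x₀ y₀ y₁ (x + σ) (y + τ) = doublingPenalty α β ν x₀ y₀ y₁ x y +
      inner ℝ (α • (x - y) + ν • (x - x₀)) σ +
      inner ℝ (β • (y - y₁) + ν • (y - y₀) - α • (x - y)) τ +
      1 / 2 * (α * ‖σ - τ‖ ^ 2 + β * ‖τ‖ ^ 2 + ν * (‖σ‖ ^ 2 + ‖τ‖ ^ 2)) := by
  have e1 : x + σ - (y + τ) = (x - y) + (σ - τ) := by abel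
  have e2 : y + τ - y₁ = (y - y₁) + τ := by abel
  have e3 : x + σ - x₀ = (x - x₀) + σ := by abel
  have e4 : y + τ - y₀ = (y - y₀) + τ := by abel
  simp only [doublingPenalty, e1, e2, e3, e4, norm_add_sq_real, inner_add_left,
    real_inner_smul_left, inner_sub_left (𝕜 := ℝ) (β • (y - y₁) + ν • (y - y₀)),
    inner_sub_right (𝕜 := ℝ) (x - y) σ τ]
  ring

theorem continuous_doublingPenalty (α β ν : ℝ) (x₀ y₀ y₁ : Euc n) :
    Continuous fun z : Euc n × Euc n => doublingPenalty α β ν x₀ y₀ y₁ z.1 z.2 := by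
  unfold doublingPenalty
  fun_prop


theorem exists_expansion_of_comp {P F : Type*} [NormedAddCommGroup P] [InnerProductSpace ℝ P]
    [FiniteDimensional ℝ P] [NormedAddCommGroup F] [InnerProductSpace ℝ F] [FiniteDimensional ℝ F]
    {W : P → ℝ} {z p : P} {S : P →L[ℝ] P} {i : F →L[ℝ] P} {f : F → ℝ} {x a p' : F} {c : ℝ}
    (hS : ∀ ε : ℝ, 0 < ε → ∀ᶠ h in 𝓝 (0 : P),
      |W (z + h) - W z - inner ℝ p h - 1 / 2 * inner ℝ (S h) h| ≤ ε * ‖h‖ ^ 2)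
    (hi : ∀ h, ‖i h‖ ^ 2 = ‖h‖ ^ 2) (hp : ∀ h, inner ℝ p (i h) = inner ℝ p' h)
    (hW : ∀ h, W (z + i h) - W z = f (x + h) - f x - inner ℝ a h - 1 / 2 * (c * ‖h‖ ^ 2)) :
    ∃ T : F →L[ℝ] F, ∀ ε : ℝ, 0 < ε → ∀ᶠ h in 𝓝 (0 : F),
      |f (x + h) - f x - inner ℝ (p' + a) h - 1 / 2 * inner ℝ (T h) h| ≤ ε * ‖h‖ ^ 2 := by
  have := FiniteDimensional.complete ℝ P
  have := FiniteDimensional.complete ℝ F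
  refine ⟨(ContinuousLinearMap.adjoint i).comp (S.comp i) + c • ContinuousLinearMap.id ℝ _,
    fun ε hε => ?_⟩
  have htend : Tendsto i (𝓝 0) (𝓝 0) := by simpa using i.continuous.tendsto 0
  filter_upwards [htend.eventually (hS ε hε)] with h hh
  rw [hi, hW, hp] at hh
  refine le_trans (le_of_eq ?_) hh
  congr 1
  change _ - 1 / 2 * inner ℝ (ContinuousLinearMap.adjoint i (S (i h)) + c • h) h = _
  rw [inner_add_left, inner_add_left, ContinuousLinearMap.adjoint_inner_left,
    real_inner_smul_left, real_inner_self_eq_norm_sq]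
  ring

/-- At a maximum of a doubled function, second-order expansions satisfy the matrix inequality
given by the penalty. -/
theorem inner_add_inner_le_of_max_doubling {f g : Euc n → ℝ} {α β ν : ℝ}
    {x₀ y₀ y₁ x y p₁ p₂ : Euc n} {T₁ T₂ : Euc n →L[ℝ] Euc n}
    (hmax : ∀ x' y', f x' + g y' - doublingPenalty α β ν x₀ y₀ y₁ x' y' -
          (inner ℝ p₁ x' + inner ℝ p₂ y') ≤
        f x + g y - doublingPenalty α β ν x₀ y₀ y₁ x y - (inner ℝ p₁ x + inner ℝ p₂ y))
    (hexp₁ : ∀ ε : ℝ, 0 < ε → ∀ᶠ h in 𝓝 (0 : Euc n),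
        |f (x + h) - f x - inner ℝ (p₁ + (α • (x - y) + ν • (x - x₀))) h
          - 1 / 2 * inner ℝ (T₁ h) h| ≤ ε * ‖h‖ ^ 2)
    (hexp₂ : ∀ ε : ℝ, 0 < ε → ∀ᶠ h in 𝓝 (0 : Euc n),
        |g (y + h) - g y - inner ℝ (p₂ + (β • (y - y₁) + ν • (y - y₀) - α • (x - y))) h
          - 1 / 2 * inner ℝ (T₂ h) h| ≤ ε * ‖h‖ ^ 2) (σ τ : Euc n) :
    inner ℝ (T₁ σ) σ + inner ℝ (T₂ τ) τ ≤
        α * ‖σ - τ‖ ^ 2 + β * ‖τ‖ ^ 2 + ν * (‖σ‖ ^ 2 + ‖τ‖ ^ 2) := by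
  have key : ∀ ε : ℝ, 0 < ε → inner ℝ (T₁ σ) σ + inner ℝ (T₂ τ) τ ≤
      (α * ‖σ - τ‖ ^ 2 + β * ‖τ‖ ^ 2 + ν * (‖σ‖ ^ 2 + ‖τ‖ ^ 2)) +
        2 * ε * (‖σ‖ ^ 2 + ‖τ‖ ^ 2) := by
    intro ε hε
    have ht : ∀ v : Euc n, Tendsto (fun t : ℝ => t • v) (𝓝[>] 0) (𝓝 0) := by
      intro v
      have : Tendsto (fun t : ℝ => t • v) (𝓝 0) (𝓝 ((0 : ℝ) • v)) :=
        (continuous_id.smul continuous_const).tendsto 0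
      rw [zero_smul] at this
      exact this.mono_left nhdsWithin_le_nhds
    obtain ⟨t, ⟨h1, h2⟩, htpos⟩ := (((ht σ).eventually (hexp₁ ε hε)).and
      ((ht τ).eventually (hexp₂ ε hε)) |>.and self_mem_nhdsWithin).exists
    have htpos : 0 < t := htpos
    have h3 := hmax (x + t • σ) (y + t • τ)
    have h4 := doublingPenalty_add α β ν x₀ y₀ y₁ x y (t • σ) (t • τ)
    rw [← smul_sub] at h4
    have h1 := (abs_le.1 h1).1
    have h2 := (abs_le.1 h2).1
    rw [inner_add_left (𝕜 := ℝ) p₁] at h1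
    rw [inner_add_left (𝕜 := ℝ) p₂] at h2
    simp only [h4] at h3
    rw [inner_add_right, inner_add_right] at h3
    simp only [map_smul, real_inner_smul_left (T₁ σ), real_inner_smul_left (T₂ τ),
      real_inner_smul_right (T₁ σ), real_inner_smul_right (T₂ τ), norm_smul, mul_pow,
      Real.norm_eq_abs, sq_abs] at h1 h2 h3
    have h5 : t ^ 2 * (inner ℝ (T₁ σ) σ + inner ℝ (T₂ τ) τ) ≤ t ^ 2 *
        ((α * ‖σ - τ‖ ^ 2 + β * ‖τ‖ ^ 2 + ν * (‖σ‖ ^ 2 + ‖τ‖ ^ 2)) +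
        2 * ε * (‖σ‖ ^ 2 + ‖τ‖ ^ 2)) := by
      nlinarith
    exact le_of_mul_le_mul_left h5 (by positivity)
  have hlim : Tendsto (fun ε : ℝ => (α * ‖σ - τ‖ ^ 2 + β * ‖τ‖ ^ 2 + ν * (‖σ‖ ^ 2 + ‖τ‖ ^ 2)) +
      2 * ε * (‖σ‖ ^ 2 + ‖τ‖ ^ 2)) (𝓝[>] 0) (𝓝 ((α * ‖σ - τ‖ ^ 2 + β * ‖τ‖ ^ 2 +
        ν * (‖σ‖ ^ 2 + ‖τ‖ ^ 2)) + 2 * 0 * (‖σ‖ ^ 2 + ‖τ‖ ^ 2))) :=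
    (Continuous.tendsto (by fun_prop) 0).mono_left nhdsWithin_le_nhds
  rw [mul_zero, zero_mul, add_zero] at hlim
  exact ge_of_tendsto hlim (by filter_upwards [self_mem_nhdsWithin] with ε hε using key ε hε)

/-- The Euclidean product of two copies of Euclidean space. -/
abbrev EucPair (n : ℕ) := WithLp 2 (Euc n × Euc n)

theorem EucPair.norm_sq_eq (z : EucPair n) : ‖z‖ ^ 2 = ‖z.fst‖ ^ 2 + ‖z.snd‖ ^ 2 :=
  WithLp.prod_norm_sq_eq_of_L2 z

theorem EucPair.inner_eq (z z' : EucPair n) :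
    inner ℝ z z' = inner ℝ z.fst z'.fst + inner ℝ z.snd z'.snd :=
  WithLp.prod_inner_apply z z'

/-- The inclusion of the first factor. -/
def EucPair.inl (n : ℕ) : Euc n →L[ℝ] EucPair n :=
  ((WithLp.prodContinuousLinearEquiv 2 ℝ (Euc n) (Euc n)).symm :
    Euc n × Euc n →L[ℝ] EucPair n).comp (ContinuousLinearMap.inl ℝ _ _)

/-- The inclusion of the second factor. -/
def EucPair.inr (n : ℕ) : Euc n →L[ℝ] EucPair n :=
  ((WithLp.prodContinuousLinearEquiv 2 ℝ (Euc n) (Euc n)).symm :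
    Euc n × Euc n →L[ℝ] EucPair n).comp (ContinuousLinearMap.inr ℝ _ _)

theorem EucPair.inl_fst (h : Euc n) : (EucPair.inl n h).fst = h := rfl

theorem EucPair.inl_snd (h : Euc n) : (EucPair.inl n h).snd = 0 := rfl

theorem EucPair.inr_fst (h : Euc n) : (EucPair.inr n h).fst = 0 := rfl

theorem EucPair.inr_snd (h : Euc n) : (EucPair.inr n h).snd = h := rfl

/-- The doubled function with quadratic penalty, on the Euclidean product. -/
def doubledFun (f g : Euc n → ℝ) (α β ν : ℝ) (x₀ y₀ y₁ : Euc n) (z : EucPair n) : ℝ :=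
  f z.fst + g z.snd - doublingPenalty α β ν x₀ y₀ y₁ z.fst z.snd

theorem doubledFun_semiconvex {f g : Euc n → ℝ} {lam α β ν : ℝ}
    (hfs : ∀ x, ∃ m : Euc n, ∀ x', f x + inner ℝ m (x' - x) - lam / 2 * ‖x' - x‖ ^ 2 ≤ f x')
    (hgs : ∀ x, ∃ m : Euc n, ∀ x', g x + inner ℝ m (x' - x) - lam / 2 * ‖x' - x‖ ^ 2 ≤ g x')
    (hα : 0 ≤ α) (hβ : 0 ≤ β) (x₀ y₀ y₁ : Euc n) (z : EucPair n) :
    ∃ m : EucPair n, ∀ z', doubledFun f g α β ν x₀ y₀ y₁ z + inner ℝ m (z' - z)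
      - (lam + (2 * α + β + ν)) / 2 * ‖z' - z‖ ^ 2 ≤ doubledFun f g α β ν x₀ y₀ y₁ z' := by
  obtain ⟨m₁, hm₁⟩ := hfs z.fst
  obtain ⟨m₂, hm₂⟩ := hgs z.snd
  refine ⟨WithLp.toLp 2 (m₁ - (α • (z.fst - z.snd) + ν • (z.fst - x₀)),
    m₂ - (β • (z.snd - y₁) + ν • (z.snd - y₀) - α • (z.fst - z.snd))), fun z' => ?_⟩
  have h1 := hm₁ z'.fst
  have h2 := hm₂ z'.snd
  have h3 := doublingPenalty_add α β ν x₀ y₀ y₁ z.fst z.snd (z'.fst - z.fst) (z'.snd - z.snd)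
  rw [add_sub_cancel, add_sub_cancel] at h3
  have h4 : ‖(z'.fst - z.fst) - (z'.snd - z.snd)‖ ^ 2 ≤
      2 * (‖z'.fst - z.fst‖ ^ 2 + ‖z'.snd - z.snd‖ ^ 2) := by
    have := norm_sub_le (z'.fst - z.fst) (z'.snd - z.snd)
    nlinarith [sq_nonneg (‖z'.fst - z.fst‖ - ‖z'.snd - z.snd‖),
      norm_nonneg ((z'.fst - z.fst) - (z'.snd - z.snd))]
  have h5 := mul_le_mul_of_nonneg_left h4 hα
  have h6 : 0 ≤ β * ‖z'.fst - z.fst‖ ^ 2 := by positivity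
  rw [EucPair.inner_eq, EucPair.norm_sq_eq]
  change doubledFun f g α β ν x₀ y₀ y₁ z +
    (inner ℝ (m₁ - (α • (z.fst - z.snd) + ν • (z.fst - x₀))) (z'.fst - z.fst) +
    inner ℝ (m₂ - (β • (z.snd - y₁) + ν • (z.snd - y₀) - α • (z.fst - z.snd)))
      (z'.snd - z.snd)) - (lam + (2 * α + β + ν)) / 2 *
    (‖z'.fst - z.fst‖ ^ 2 + ‖z'.snd - z.snd‖ ^ 2) ≤ doubledFun f g α β ν x₀ y₀ y₁ z'
  unfold doubledFun
  rw [inner_sub_left (𝕜 := ℝ) m₁, inner_sub_left (𝕜 := ℝ) m₂]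
  linarith

theorem exists_max_doubledFun {f g : Euc n → ℝ} {B α β ν : ℝ} (hf : Continuous f)
    (hg : Continuous g) (hfB : ∀ x, f x ≤ B) (hgB : ∀ x, g x ≤ B)
    (hα : 0 ≤ α) (hβ : 0 ≤ β) (hν : 0 < ν) (x₀ y₀ y₁ : Euc n) (p : EucPair n) :
    ∃ z, ∀ z', doubledFun f g α β ν x₀ y₀ y₁ z' - inner ℝ p z' ≤
      doubledFun f g α β ν x₀ y₀ y₁ z - inner ℝ p z := by
  have hfst : Continuous fun z : EucPair n => z.fst := by fun_prop
  have hsnd : Continuous fun z : EucPair n => z.snd := by fun_prop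
  have hWcont : Continuous (doubledFun f g α β ν x₀ y₀ y₁) := by
    have := (continuous_doublingPenalty α β ν x₀ y₀ y₁).comp (hfst.prodMk hsnd)
    exact ((hf.comp hfst).add (hg.comp hsnd)).sub this
  refine exists_max_of_le_quadratic (g := fun z => doubledFun f g α β ν x₀ y₀ y₁ z - inner ℝ p z)
    (by fun_prop) (C := 2 * B) (c := ‖p‖) (ν := ν / 2) (z := WithLp.toLp 2 (x₀, y₀))
    (norm_nonneg _) (by positivity) fun z' => ?_
  have h1 := neg_le_of_abs_le (abs_real_inner_le_norm p z')
  have h2 : ν / 2 * (‖z'.fst - x₀‖ ^ 2 + ‖z'.snd - y₀‖ ^ 2) ≤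
      doublingPenalty α β ν x₀ y₀ y₁ z'.fst z'.snd := by
    unfold doublingPenalty
    have : 0 ≤ α / 2 * ‖z'.fst - z'.snd‖ ^ 2 + β / 2 * ‖z'.snd - y₁‖ ^ 2 := by positivity
    linarith
  rw [EucPair.norm_sq_eq]
  change f z'.fst + g z'.snd - doublingPenalty α β ν x₀ y₀ y₁ z'.fst z'.snd - inner ℝ p z' ≤
    2 * B + ‖p‖ * ‖z'‖ - ν / 2 * (‖z'.fst - x₀‖ ^ 2 + ‖z'.snd - y₀‖ ^ 2)
  linarith [hfB z'.fst, hgB z'.snd]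

/-- Jensen-type lemma for the doubling of variables with semiconvex functions. -/
theorem exists_doubling_expansion {f g : Euc n → ℝ} {B lam α β ν ρ : ℝ} (hf : Continuous f)
    (hg : Continuous g) (hfB : ∀ x, f x ≤ B) (hgB : ∀ x, g x ≤ B) (hlam : 0 ≤ lam)
    (hfs : ∀ x, ∃ m : Euc n, ∀ x', f x + inner ℝ m (x' - x) - lam / 2 * ‖x' - x‖ ^ 2 ≤ f x')
    (hgs : ∀ x, ∃ m : Euc n, ∀ x', g x + inner ℝ m (x' - x) - lam / 2 * ‖x' - x‖ ^ 2 ≤ g x')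
    (hα : 0 ≤ α) (hβ : 0 ≤ β) (hν : 0 < ν) (hρ : 0 < ρ) (x₀ y₀ y₁ : Euc n) :
    ∃ (x y p₁ p₂ : Euc n) (T₁ T₂ : Euc n →L[ℝ] Euc n), ‖p₁‖ ≤ ρ ∧ ‖p₂‖ ≤ ρ ∧
      (∀ x' y', f x' + g y' - doublingPenalty α β ν x₀ y₀ y₁ x' y' -
          (inner ℝ p₁ x' + inner ℝ p₂ y') ≤
        f x + g y - doublingPenalty α β ν x₀ y₀ y₁ x y - (inner ℝ p₁ x + inner ℝ p₂ y)) ∧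
      (∀ ε : ℝ, 0 < ε → ∀ᶠ h in 𝓝 (0 : Euc n),
        |f (x + h) - f x - inner ℝ (p₁ + (α • (x - y) + ν • (x - x₀))) h
          - 1 / 2 * inner ℝ (T₁ h) h| ≤ ε * ‖h‖ ^ 2) ∧
      (∀ ε : ℝ, 0 < ε → ∀ᶠ h in 𝓝 (0 : Euc n),
        |g (y + h) - g y - inner ℝ (p₂ + (β • (y - y₁) + ν • (y - y₀) - α • (x - y))) h
          - 1 / 2 * inner ℝ (T₂ h) h| ≤ ε * ‖h‖ ^ 2) ∧
      ∀ σ τ : Euc n, inner ℝ (T₁ σ) σ + inner ℝ (T₂ τ) τ ≤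
        α * ‖σ - τ‖ ^ 2 + β * ‖τ‖ ^ 2 + ν * (‖σ‖ ^ 2 + ‖τ‖ ^ 2) := by
  obtain ⟨p, hp, hpmax⟩ := exists_perturbation_forall_max_expansion
    (W := doubledFun f g α β ν x₀ y₀ y₁) (by positivity)
    (doubledFun_semiconvex hfs hgs hα hβ x₀ y₀ y₁) hρ
  obtain ⟨z, hz⟩ := exists_max_doubledFun hf hg hfB hgB hα hβ hν x₀ y₀ y₁ p
  obtain ⟨S, hS⟩ := hpmax z hz
  have hψ := doublingPenalty_add α β ν x₀ y₀ y₁ z.fst z.snd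
  have hpn := EucPair.norm_sq_eq p
  have hp₁ : ‖p.fst‖ ≤ ρ :=
    (abs_le_of_sq_le_sq' (by nlinarith [sq_nonneg ‖p.snd‖, norm_nonneg p]) hρ.le).2
  have hp₂ : ‖p.snd‖ ≤ ρ :=
    (abs_le_of_sq_le_sq' (by nlinarith [sq_nonneg ‖p.fst‖, norm_nonneg p]) hρ.le).2
  have hmax : ∀ x' y', f x' + g y' - doublingPenalty α β ν x₀ y₀ y₁ x' y' -
      (inner ℝ p.fst x' + inner ℝ p.snd y') ≤
      f z.fst + g z.snd - doublingPenalty α β ν x₀ y₀ y₁ z.fst z.snd -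
        (inner ℝ p.fst z.fst + inner ℝ p.snd z.snd) := by
    intro x' y'
    have := hz (WithLp.toLp 2 (x', y'))
    rwa [EucPair.inner_eq, EucPair.inner_eq] at this
  obtain ⟨T₁, hT₁⟩ := exists_expansion_of_comp (i := EucPair.inl n) (f := f) (x := z.fst)
    (a := α • (z.fst - z.snd) + ν • (z.fst - x₀)) (p' := p.fst) (c := α + ν) hS
    (fun h => by rw [EucPair.norm_sq_eq, EucPair.inl_fst, EucPair.inl_snd]; simp)
    (fun h => by rw [EucPair.inner_eq, EucPair.inl_fst, EucPair.inl_snd]; simp)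
    (fun h => by
      have h3 := hψ h 0
      rw [add_zero, sub_zero, inner_zero_right, norm_zero] at h3
      change f (z.fst + h) + g (z.snd + 0) - doublingPenalty α β ν x₀ y₀ y₁ (z.fst + h)
        (z.snd + 0) - (f z.fst + g z.snd - doublingPenalty α β ν x₀ y₀ y₁ z.fst z.snd) = _
      rw [add_zero, h3]
      ring)
  obtain ⟨T₂, hT₂⟩ := exists_expansion_of_comp (i := EucPair.inr n) (f := g) (x := z.snd)
    (a := β • (z.snd - y₁) + ν • (z.snd - y₀) - α • (z.fst - z.snd)) (p' := p.snd)
    (c := α + β + ν) hS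
    (fun h => by rw [EucPair.norm_sq_eq, EucPair.inr_fst, EucPair.inr_snd]; simp)
    (fun h => by rw [EucPair.inner_eq, EucPair.inr_fst, EucPair.inr_snd]; simp)
    (fun h => by
      have h3 := hψ 0 h
      rw [add_zero, zero_sub, inner_zero_right, norm_zero, norm_neg] at h3
      change f (z.fst + 0) + g (z.snd + h) - doublingPenalty α β ν x₀ y₀ y₁ (z.fst + 0)
        (z.snd + h) - (f z.fst + g z.snd - doublingPenalty α β ν x₀ y₀ y₁ z.fst z.snd) = _
      rw [add_zero, h3]
      ring)
  exact ⟨z.fst, z.snd, p.fst, p.snd, T₁, T₂, hp₁, hp₂, hmax, hT₁, hT₂,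
    inner_add_inner_le_of_max_doubling hmax hT₁ hT₂⟩

/-- The `l`-th column of a matrix as a Euclidean vector. -/
def matCol (M : Matrix (Fin n) (Fin n) ℝ) (l : Fin n) : Euc n := WithLp.toLp 2 fun i => M i l

/-- The squared Frobenius norm. -/
def frobSq (M : Matrix (Fin n) (Fin n) ℝ) : ℝ := ∑ l, ∑ i, M i l ^ 2

theorem frobSq_eq (M : Matrix (Fin n) (Fin n) ℝ) : frobSq M = ∑ l, ‖matCol M l‖ ^ 2 := by
  simp [frobSq, matCol, EuclideanSpace.norm_sq_eq]

theorem frobSq_nonneg (M : Matrix (Fin n) (Fin n) ℝ) : 0 ≤ frobSq M := by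
  unfold frobSq
  positivity

theorem columnTrace_add_id (M : Matrix (Fin n) (Fin n) ℝ) (T : Euc n →L[ℝ] Euc n) (c : ℝ) :
    columnTrace M (T + c • ContinuousLinearMap.id ℝ (Euc n)) =
      columnTrace M T + c * frobSq M := by
  rw [frobSq_eq, columnTrace, columnTrace, Finset.mul_sum, ← Finset.sum_add_distrib]
  refine Finset.sum_congr rfl fun l _ => ?_
  change inner ℝ (T (matCol M l) + c • matCol M l) (matCol M l) = _
  rw [inner_add_left, real_inner_smul_left, real_inner_self_eq_norm_sq]
  rfl

theorem columnTrace_neg (M : Matrix (Fin n) (Fin n) ℝ) (T : Euc n →L[ℝ] Euc n) :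
    columnTrace M (-T) = -columnTrace M T := by
  rw [columnTrace, columnTrace, ← Finset.sum_neg_distrib]
  refine Finset.sum_congr rfl fun l _ => ?_
  rw [_root_.neg_apply, inner_neg_left]

theorem columnTrace_add_le {M N : Matrix (Fin n) (Fin n) ℝ} {T₁ T₂ : Euc n →L[ℝ] Euc n}
    {α β ν : ℝ} (h : ∀ σ τ : Euc n, inner ℝ (T₁ σ) σ + inner ℝ (T₂ τ) τ ≤
        α * ‖σ - τ‖ ^ 2 + β * ‖τ‖ ^ 2 + ν * (‖σ‖ ^ 2 + ‖τ‖ ^ 2)) :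
    columnTrace M T₁ + columnTrace N T₂ ≤
      α * frobSq (M - N) + β * frobSq N + ν * (frobSq M + frobSq N) := by
  simp only [frobSq_eq, columnTrace, Finset.mul_sum, ← Finset.sum_add_distrib]
  exact Finset.sum_le_sum fun l _ => h (matCol M l) (matCol N l)

set_option maxHeartbeats 1000000 in
/-- One approximation step in the comparison of sub- and superjets at a maximum of a
doubled function. -/
theorem exists_approx_jets {u w : Euc n → ℝ} {B L α β : ℝ}
    {Sig : Euc n → Matrix (Fin n) (Fin n) ℝ} {a b : Euc n → Euc n → ℝ}
    (huB : ∀ x, |u x| ≤ B) (hwB : ∀ x, |w x| ≤ B) (hL0 : 0 ≤ L)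
    (huL : ∀ x y, |u x - u y| ≤ L * ‖x - y‖) (hwL : ∀ x y, |w x - w y| ≤ L * ‖x - y‖)
    (hα : 0 ≤ α) (hβ : 0 ≤ β)
    (hu : ∀ x q T, (∀ᶠ h in 𝓝 (0 : Euc n),
      u (x + h) ≤ u x + inner ℝ q h + 1 / 2 * inner ℝ (T h) h) → a x q ≤ columnTrace (Sig x) T)
    (hw : ∀ y q T, (∀ᶠ h in 𝓝 (0 : Euc n),
      w y + inner ℝ q h + 1 / 2 * inner ℝ (T h) h ≤ w (y + h)) → columnTrace (Sig y) T ≤ b y q)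
    {x₀ y₀ y₁ : Euc n}
    (hmax : ∀ x y, u x - w y - (α / 2 * ‖x - y‖ ^ 2 + β / 2 * ‖y - y₁‖ ^ 2) ≤
      u x₀ - w y₀ - (α / 2 * ‖x₀ - y₀‖ ^ 2 + β / 2 * ‖y₀ - y₁‖ ^ 2))
    {r : ℝ} (hr : 0 < r) (hr1 : r ≤ 1) :
    ∃ ξ η q₁ q₂ : Euc n, ‖ξ - x₀‖ ≤ (4 * L + 3) * r ∧ ‖η - y₀‖ ≤ (4 * L + 3) * r ∧
      ‖q₁ - α • (x₀ - y₀)‖ ≤ (1 + (2 * α + β + 1) * (4 * L + 3)) * r ∧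
      ‖q₂ - (α • (x₀ - y₀) - β • (y₀ - y₁))‖ ≤ (1 + (2 * α + β + 1) * (4 * L + 3)) * r ∧
      a ξ q₁ - b η q₂ ≤ α * frobSq (Sig ξ - Sig η) + β * frobSq (Sig η) +
        3 * r * (frobSq (Sig ξ) + frobSq (Sig η)) := by
  have hϵ : 0 < r ^ 3 := by positivity
  have hr3 : r ^ 3 ≤ r := by nlinarith [mul_nonneg hr.le hr.le]
  have hr2 : r ^ 2 ≤ r := by nlinarith
  have hwL' : ∀ x y, |(-w x) - (-w y)| ≤ L * ‖x - y‖ := fun x y => by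
    rw [neg_sub_neg, abs_sub_comm]; exact hwL x y
  obtain ⟨f, ξ, hfe, hfle⟩ := exists_supConvolution huB huL hϵ
  obtain ⟨g, η, hge, hgle⟩ := exists_supConvolution (u := fun x => -w x)
    (fun x => by rw [abs_neg]; exact hwB x) hwL' hϵ
  have hfu := supConvolution_le huL hϵ hfe
  have hgw := supConvolution_le (u := fun x => -w x) hwL' hϵ hge
  have hL2 : L ^ 2 * r ^ 3 / 2 ≤ L ^ 2 / 2 := by
    have : r ^ 3 ≤ 1 := hr3.trans hr1
    nlinarith [sq_nonneg L]
  obtain ⟨x, y, p₁, p₂, T₁, T₂, hp₁, hp₂, hm, he₁, he₂, hT⟩ :=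
    exists_doubling_expansion (f := f) (g := g) (B := B + L ^ 2 / 2) (lam := 1 / r ^ 3) (α := α)
      (β := β) (ν := r) (ρ := r ^ 2) (supConvolution_lipschitz huL hfe hfle)
      (supConvolution_lipschitz (u := fun x => -w x) hwL' hge hgle)
      (fun x => by linarith [hfu x, (abs_le.1 (huB x)).2])
      (fun x => by linarith [hgw x, (abs_le.1 (hwB x)).1])
      (by positivity) (supConvolution_semiconvex hfe hfle)
      (supConvolution_semiconvex (u := fun x => -w x) hge hgle) hα hβ hr (by positivity) x₀ y₀ y₁
  have hX : ‖x - x₀‖ ≤ (2 * L + 3) * r ∧ ‖y - y₀‖ ≤ (2 * L + 3) * r := by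
    have h1 := hm x₀ y₀
    have h2 := hmax x y
    have h3 := le_supConvolution hfle x₀
    have h4 := le_supConvolution (u := fun x => -w x) hgle y₀
    have h5 := hfu x
    have h6 := hgw y
    have h7 : inner ℝ p₁ (x₀ - x) ≤ r ^ 2 * ‖x - x₀‖ := by
      rw [norm_sub_rev x]
      exact (real_inner_le_norm _ _).trans (by gcongr)
    have h8 : inner ℝ p₂ (y₀ - y) ≤ r ^ 2 * ‖y - y₀‖ := by
      rw [norm_sub_rev y]
      exact (real_inner_le_norm _ _).trans (by gcongr)
    rw [inner_sub_right] at h7 h8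
    simp only [doublingPenalty, sub_self, norm_zero] at h1
    have h9 : r * (‖x - x₀‖ ^ 2 + ‖y - y₀‖ ^ 2) ≤
        r * (2 * L ^ 2 * r ^ 2 + 2 * r * (‖x - x₀‖ + ‖y - y₀‖)) := by nlinarith
    have h10 := le_of_mul_le_mul_left h9 hr
    constructor
    · have : ‖x - x₀‖ - r ≤ (2 * L + 2) * r := by
        refine (abs_le_of_sq_le_sq' ?_ (by positivity)).2
        nlinarith [sq_nonneg (‖y - y₀‖ - r), mul_nonneg hL0 (sq_nonneg r),
          sq_nonneg r, mul_nonneg (sq_nonneg L) (sq_nonneg r)]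
      linarith
    · have : ‖y - y₀‖ - r ≤ (2 * L + 2) * r := by
        refine (abs_le_of_sq_le_sq' ?_ (by positivity)).2
        nlinarith [sq_nonneg (‖x - x₀‖ - r), mul_nonneg hL0 (sq_nonneg r),
          sq_nonneg r, mul_nonneg (sq_nonneg L) (sq_nonneg r)]
      linarith
  obtain ⟨hX, hY⟩ := hX
  have hLr : 2 * L * r ^ 3 ≤ 2 * L * r := by gcongr
  have hξ := (supConvolution_dist_le huL hL0 hϵ hfe hfle x).trans hLr
  have hη := (supConvolution_dist_le (u := fun x => -w x) hwL' hL0 hϵ hge hgle y).trans hLr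
  have hLr0 : 0 ≤ L * r := by positivity
  have hX' : ‖x - x₀‖ ≤ (4 * L + 3) * r := by linarith
  have hY' : ‖y - y₀‖ ≤ (4 * L + 3) * r := by linarith
  have hrX : ‖r • (x - x₀)‖ ≤ (4 * L + 3) * r := by
    rw [norm_smul, Real.norm_of_nonneg hr.le]
    nlinarith [norm_nonneg (x - x₀)]
  have hrY : ‖r • (y - y₀)‖ ≤ (4 * L + 3) * r := by
    rw [norm_smul, Real.norm_of_nonneg hr.le]
    nlinarith [norm_nonneg (y - y₀)]
  have hαX : ‖α • ((x - x₀) - (y - y₀))‖ ≤ 2 * α * ((4 * L + 3) * r) := by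
    rw [norm_smul, Real.norm_of_nonneg hα]
    have := norm_sub_le (x - x₀) (y - y₀)
    nlinarith
  have hβY : ‖β • (y - y₀)‖ ≤ β * ((4 * L + 3) * r) := by
    rw [norm_smul, Real.norm_of_nonneg hβ]
    gcongr
  refine ⟨ξ x, η y, p₁ + (α • (x - y) + r • (x - x₀)),
    -(p₂ + (β • (y - y₁) + r • (y - y₀) - α • (x - y))), ?_, ?_, ?_, ?_, ?_⟩
  · have e : ξ x - x₀ = (x - x₀) - (x - ξ x) := by abel
    rw [e]
    linarith [norm_sub_le (x - x₀) (x - ξ x)]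
  · have e : η y - y₀ = (y - y₀) - (y - η y) := by abel
    rw [e]
    linarith [norm_sub_le (y - y₀) (y - η y)]
  · have e : p₁ + (α • (x - y) + r • (x - x₀)) - α • (x₀ - y₀) =
        p₁ + (α • ((x - x₀) - (y - y₀)) + r • (x - x₀)) := by module
    rw [e]
    have h1 := norm_add_le p₁ (α • ((x - x₀) - (y - y₀)) + r • (x - x₀))
    have h2 := norm_add_le (α • ((x - x₀) - (y - y₀))) (r • (x - x₀))
    have h3 : 0 ≤ β * ((4 * L + 3) * r) := by positivity
    linarith
  · have e : -(p₂ + (β • (y - y₁) + r • (y - y₀) - α • (x - y))) -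
        (α • (x₀ - y₀) - β • (y₀ - y₁)) =
        (α • ((x - x₀) - (y - y₀)) - r • (y - y₀)) - (p₂ + β • (y - y₀)) := by module
    rw [e]
    have h1 := norm_sub_le (α • ((x - x₀) - (y - y₀)) - r • (y - y₀)) (p₂ + β • (y - y₀))
    have h2 := norm_sub_le (α • ((x - x₀) - (y - y₀))) (r • (y - y₀))
    have h3 := norm_add_le p₂ (β • (y - y₀))
    linarith
  · have h1 := hu (ξ x) (p₁ + (α • (x - y) + r • (x - x₀)))
      (T₁ + (2 * r) • ContinuousLinearMap.id ℝ (Euc n)) (by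
        filter_upwards [he₁ r hr] with h hh
        have h1 := sub_le_supConvolution_sub hfe hfle x h
        have h2 := (abs_le.1 hh).2
        change _ ≤ _ + _ + 1 / 2 * inner ℝ (T₁ h + (2 * r) • h) h
        rw [inner_add_left (𝕜 := ℝ) (T₁ h), real_inner_smul_left, real_inner_self_eq_norm_sq]
        linarith)
    have h2 := hw (η y) (-(p₂ + (β • (y - y₁) + r • (y - y₀) - α • (x - y))))
      (-(T₂ + (2 * r) • ContinuousLinearMap.id ℝ (Euc n))) (by
        filter_upwards [he₂ r hr] with h hh
        have h1 := sub_le_supConvolution_sub (u := fun x => -w x) hge hgle y h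
        have h2 := (abs_le.1 hh).2
        change _ + _ + 1 / 2 * inner ℝ (-(T₂ h + (2 * r) • h)) h ≤ _
        rw [inner_neg_left, inner_neg_left, inner_add_left (𝕜 := ℝ) (T₂ h), real_inner_smul_left,
          real_inner_self_eq_norm_sq]
        linarith)
    rw [columnTrace_add_id] at h1
    rw [columnTrace_neg, columnTrace_add_id] at h2
    have h3 := columnTrace_add_le (M := Sig (ξ x)) (N := Sig (η y)) hT
    linarith

/-- Comparison of sub- and superjets at a maximum of a doubled function. -/
theorem jets_sub_le_of_max {u w : Euc n → ℝ} {B L α β : ℝ}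
    {Sig : Euc n → Matrix (Fin n) (Fin n) ℝ} {a b : Euc n → Euc n → ℝ}
    (hSig : ∀ i j, Continuous fun x => Sig x i j)
    (ha : Continuous fun z : Euc n × Euc n => a z.1 z.2)
    (hb : Continuous fun z : Euc n × Euc n => b z.1 z.2)
    (huB : ∀ x, |u x| ≤ B) (hwB : ∀ x, |w x| ≤ B) (hL0 : 0 ≤ L)
    (huL : ∀ x y, |u x - u y| ≤ L * ‖x - y‖) (hwL : ∀ x y, |w x - w y| ≤ L * ‖x - y‖)
    (hα : 0 ≤ α) (hβ : 0 ≤ β)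
    (hu : ∀ x q T, (∀ᶠ h in 𝓝 (0 : Euc n),
      u (x + h) ≤ u x + inner ℝ q h + 1 / 2 * inner ℝ (T h) h) → a x q ≤ columnTrace (Sig x) T)
    (hw : ∀ y q T, (∀ᶠ h in 𝓝 (0 : Euc n),
      w y + inner ℝ q h + 1 / 2 * inner ℝ (T h) h ≤ w (y + h)) → columnTrace (Sig y) T ≤ b y q)
    {x₀ y₀ y₁ : Euc n}
    (hmax : ∀ x y, u x - w y - (α / 2 * ‖x - y‖ ^ 2 + β / 2 * ‖y - y₁‖ ^ 2) ≤
      u x₀ - w y₀ - (α / 2 * ‖x₀ - y₀‖ ^ 2 + β / 2 * ‖y₀ - y₁‖ ^ 2)) :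
    a x₀ (α • (x₀ - y₀)) - b y₀ (α • (x₀ - y₀) - β • (y₀ - y₁)) ≤
      α * frobSq (Sig x₀ - Sig y₀) + β * frobSq (Sig y₀) := by
  have hr : ∀ N : ℕ, 0 < 1 / ((N : ℝ) + 1) := fun N => by positivity
  have hr1 : ∀ N : ℕ, 1 / ((N : ℝ) + 1) ≤ 1 := fun N => by
    rw [div_le_one (by positivity)]
    linarith [Nat.cast_nonneg (α := ℝ) N]
  choose ξ η q₁ q₂ hξ hη hq₁ hq₂ hle using fun N =>
    exists_approx_jets huB hwB hL0 huL hwL hα hβ hu hw hmax (hr N) (hr1 N)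
  have hlim : ∀ {z : ℕ → Euc n} {z₀ : Euc n} {K : ℝ},
      (∀ N : ℕ, ‖z N - z₀‖ ≤ K * (1 / ((N : ℝ) + 1))) → Tendsto z atTop (𝓝 z₀) := by
    intro z z₀ K hz
    rw [tendsto_iff_norm_sub_tendsto_zero]
    have := (tendsto_one_div_add_atTop_nhds_zero_nat (𝕜 := ℝ)).const_mul K
    rw [mul_zero] at this
    exact squeeze_zero (fun _ => norm_nonneg _) hz this
  have hfrob : ∀ {M : ℕ → Matrix (Fin n) (Fin n) ℝ} {M₀ : Matrix (Fin n) (Fin n) ℝ},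
      (∀ i j, Tendsto (fun N => M N i j) atTop (𝓝 (M₀ i j))) →
      Tendsto (fun N => frobSq (M N)) atTop (𝓝 (frobSq M₀)) := fun h =>
    tendsto_finsetSum _ fun l _ => tendsto_finsetSum _ fun i _ => (h i l).pow 2
  have hξ' := hlim hξ
  have hη' := hlim hη
  have hS₁ : ∀ i j, Tendsto (fun N => Sig (ξ N) i j) atTop (𝓝 (Sig x₀ i j)) := fun i j =>
    ((hSig i j).tendsto x₀).comp hξ'
  have hS₂ : ∀ i j, Tendsto (fun N => Sig (η N) i j) atTop (𝓝 (Sig y₀ i j)) := fun i j =>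
    ((hSig i j).tendsto y₀).comp hη'
  have h1 := (ha.tendsto (x₀, α • (x₀ - y₀))).comp (hξ'.prodMk_nhds (hlim hq₁))
  have h2 := (hb.tendsto (y₀, α • (x₀ - y₀) - β • (y₀ - y₁))).comp (hη'.prodMk_nhds (hlim hq₂))
  have h3 := ((hfrob (M := fun N => Sig (ξ N) - Sig (η N)) (M₀ := Sig x₀ - Sig y₀)
    fun i j => (hS₁ i j).sub (hS₂ i j)).const_mul α).add ((hfrob hS₂).const_mul β)
  have h4 := ((tendsto_one_div_add_atTop_nhds_zero_nat (𝕜 := ℝ)).const_mul 3).mul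
    ((hfrob hS₁).add (hfrob hS₂))
  have h5 := h3.add h4
  rw [mul_zero, zero_mul, add_zero] at h5
  exact le_of_tendsto_of_tendsto' (h1.sub h2) h5 hle

end

section

variable {n m : ℕ} {S : Setting n m} {p : Euc n} {r δ : ℝ} {ω : S.Ω} {v : Fin m → Euc n → ℝ}
  {k : Fin m}

theorem columnTrace_smul_id (M : Matrix (Fin n) (Fin n) ℝ) (c : ℝ) :
    columnTrace M (c • ContinuousLinearMap.id ℝ (Euc n)) = c * frobSq M := by
  have := columnTrace_add_id M 0 c
  rw [zero_add] at this
  rw [this]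
  simp [columnTrace]

theorem IsViscSubOn.le_columnTrace (hv : IsViscSubOn (macroOp S p r δ ω) Set.univ v)
    {x q : Euc n} {T : Euc n →L[ℝ] Euc n}
    (h : ∀ᶠ h in 𝓝 (0 : Euc n), v k (x + h) ≤ v k x + inner ℝ q h + 1 / 2 * inner ℝ (T h) h) :
    δ * v k x + S.H k (p + q) (fun _ => r) (fun j => v k x - v j x) x ω ≤
      columnTrace (S.Sig k x ω) T := by
  have h1 := hv k (quadPoly x q T) (contDiff_quadPoly x q T) x (Set.mem_univ x) (by
    rw [IsLocalMaxOn, nhdsWithin_univ]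
    have ht : Tendsto (fun y => y - x) (𝓝 x) (𝓝 0) := by
      simpa using (continuous_id.sub continuous_const).tendsto (x := x) (f := fun y => y - x)
    filter_upwards [ht.eventually h] with y hy
    rw [add_sub_cancel] at hy
    simp only [quadPoly, sub_self, inner_zero_right, mul_zero]
    linarith)
  rw [macroOp, gradient_quadPoly, S.A_sq, trace_mul_hess_quadPoly] at h1
  linarith

theorem IsViscSupOn.columnTrace_le (hv : IsViscSupOn (macroOp S p r δ ω) Set.univ v)
    {x q : Euc n} {T : Euc n →L[ℝ] Euc n}
    (h : ∀ᶠ h in 𝓝 (0 : Euc n), v k x + inner ℝ q h + 1 / 2 * inner ℝ (T h) h ≤ v k (x + h)) :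
    columnTrace (S.Sig k x ω) T ≤
      δ * v k x + S.H k (p + q) (fun _ => r) (fun j => v k x - v j x) x ω := by
  have h1 := hv k (quadPoly x q T) (contDiff_quadPoly x q T) x (Set.mem_univ x) (by
    rw [IsLocalMinOn, nhdsWithin_univ]
    have ht : Tendsto (fun y => y - x) (𝓝 x) (𝓝 0) := by
      simpa using (continuous_id.sub continuous_const).tendsto (x := x) (f := fun y => y - x)
    filter_upwards [ht.eventually h] with y hy
    rw [add_sub_cancel] at hy
    simp only [quadPoly, sub_self, inner_zero_right, mul_zero]
    linarith)
  rw [macroOp, gradient_quadPoly, S.A_sq, trace_mul_hess_quadPoly] at h1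
  linarith

theorem IsViscSubOn.le_of_max_sub_sq (hv : IsViscSubOn (macroOp S p r δ ω) Set.univ v)
    {c : ℝ} {x y₁ : Euc n}
    (h : ∀ y, v k y - c / 2 * ‖y - y₁‖ ^ 2 ≤ v k x - c / 2 * ‖x - y₁‖ ^ 2) :
    δ * v k x + S.H k (p + c • (x - y₁)) (fun _ => r) (fun j => v k x - v j x) x ω ≤
      c * frobSq (S.Sig k x ω) := by
  rw [← columnTrace_smul_id]
  refine hv.le_columnTrace (Eventually.of_forall fun z => ?_)
  have h1 := h (x + z)
  have e : x + z - y₁ = (x - y₁) + z := by abel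
  rw [e, norm_add_sq_real] at h1
  change _ ≤ _ + _ + 1 / 2 * inner ℝ (c • z) z
  rw [real_inner_smul_left, real_inner_smul_left, real_inner_self_eq_norm_sq]
  linarith

theorem IsViscSupOn.le_of_min_add_sq (hv : IsViscSupOn (macroOp S p r δ ω) Set.univ v)
    {c : ℝ} {x y₁ : Euc n}
    (h : ∀ y, v k x + c / 2 * ‖x - y₁‖ ^ 2 ≤ v k y + c / 2 * ‖y - y₁‖ ^ 2) :
    -(c * frobSq (S.Sig k x ω)) ≤
      δ * v k x + S.H k (p - c • (x - y₁)) (fun _ => r) (fun j => v k x - v j x) x ω := by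
  rw [← columnTrace_smul_id, ← columnTrace_neg, sub_eq_add_neg]
  refine hv.columnTrace_le (Eventually.of_forall fun z => ?_)
  have h1 := h (x + z)
  have e : x + z - y₁ = (x - y₁) + z := by abel
  rw [e, norm_add_sq_real] at h1
  change _ + _ + 1 / 2 * inner ℝ (-(c • z)) z ≤ _
  rw [inner_neg_left, inner_neg_left, real_inner_smul_left, real_inner_smul_left,
    real_inner_self_eq_norm_sq]
  linarith

theorem posMaxOff_nonneg (k : Fin m) (s : Fin m → ℝ) : 0 ≤ posMaxOff k s := NNReal.coe_nonneg _

theorem le_posMaxOff {s : Fin m → ℝ} (hs : s k = 0) (j : Fin m) : s j ≤ posMaxOff k s := by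
  rcases eq_or_ne j k with rfl | hj
  · rw [hs]
    exact posMaxOff_nonneg _ _
  · refine (Real.le_coe_toNNReal _).trans (NNReal.coe_le_coe.2 ?_)
    exact Finset.le_sup (f := fun i => (s i).toNNReal) (Finset.mem_erase.2 ⟨hj, Finset.mem_univ j⟩)

/-- The Hamiltonian is monotone in the vector of differences. -/
theorem Setting.H_monotone_s (S : Setting n m) (k : Fin m) (p : Euc n) (r : Fin m → ℝ) (y : Euc n)
    (ω : S.Ω) : Monotone fun s => S.H k p r s y ω := by
  intro s s' hs
  have key : ∀ t : Finset (Fin m), S.H k p r s y ω ≤ S.H k p r (t.piecewise s' s) y ω := by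
    intro t
    induction t using Finset.induction_on with
    | empty => simp
    | insert i t hi ih =>
      refine ih.trans ?_
      rw [Finset.piecewise_insert]
      have h1 := S.H_mono_s k p r (t.piecewise s' s) y ω i (s i) (s' i) (hs i)
      have e : Function.update (t.piecewise s' s) i (s i) = t.piecewise s' s := by
        rw [Function.update_eq_self_iff, Finset.piecewise_eq_of_notMem _ _ _ hi]
      rwa [e] at h1
  have := key Finset.univ
  rwa [Finset.piecewise_univ] at this

theorem Setting.continuous_H (S : Setting n m) (k : Fin m) (r : Fin m → ℝ) (ω : S.Ω) :
    Continuous fun z : Euc n × (Fin m → ℝ) × Euc n => S.H k z.1 r z.2.1 z.2.2 ω := by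
  refine continuous_iff_continuousAt.2 fun z₀ => ?_
  obtain ⟨C, -, hC⟩ := S.H_cont (‖r‖ + ‖z₀.2.1‖ + 1) (by positivity)
  have hγ : 0 ≤ S.γ k - 1 := by linarith [S.γ_gt_one k]
  have hcont : Continuous fun z : Euc n × (Fin m → ℝ) × Euc n =>
      C * ((1 + ‖z.1‖ + ‖z₀.1‖) ^ (S.γ k - 1) * ‖z.1 - z₀.1‖ + ‖r - r‖ + ‖z.2.1 - z₀.2.1‖ +
        ‖z.2.2 - z₀.2.2‖) := by
    have h1 : Continuous fun z : Euc n × (Fin m → ℝ) × Euc n =>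
        (1 + ‖z.1‖ + ‖z₀.1‖) ^ (S.γ k - 1) :=
      Continuous.rpow_const (by fun_prop) fun _ => Or.inr hγ
    fun_prop
  have h0 := hcont.tendsto z₀
  simp only [sub_self, norm_zero, mul_zero, add_zero] at h0
  have hs : ∀ᶠ z : Euc n × (Fin m → ℝ) × Euc n in 𝓝 z₀, ‖z.2.1‖ < ‖z₀.2.1‖ + 1 := by
    have : Continuous fun z : Euc n × (Fin m → ℝ) × Euc n => ‖z.2.1‖ := by fun_prop
    exact (this.tendsto z₀).eventually_lt_const (by linarith)
  rw [ContinuousAt, tendsto_iff_norm_sub_tendsto_zero]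
  refine squeeze_zero' (Eventually.of_forall fun _ => norm_nonneg _) ?_ h0
  filter_upwards [hs] with z hz
  have := hC k z.1 z₀.1 r r z.2.1 z₀.2.1 z.2.2 z₀.2.2 ω
    (by linarith [norm_nonneg z₀.2.1]) (by linarith [norm_nonneg z₀.2.1])
    (by linarith [norm_nonneg r]) (by linarith [norm_nonneg r])
  simpa only [sub_self, norm_zero, add_zero, Real.norm_eq_abs] using this

/-- Quantitative consequences of the standing assumptions at a fixed environment and for
`|r| ≤ R`. -/
structure CellBounds (S : Setting n m) (ω : S.Ω) (R : ℝ) where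
  (CA C₁ C₂ C₃ : ℝ)
  (C₄ C₅ : ℝ → ℝ)
  R_pos : 0 < R
  CA_nonneg : 0 ≤ CA
  C₁_pos : 0 < C₁
  C₂_pos : 0 < C₂
  C₃_pos : 0 < C₃
  C₄_nonneg : ∀ ρ, 0 ≤ C₄ ρ
  C₅_nonneg : ∀ ρ, 0 ≤ C₅ ρ
  frobSq_le : ∀ k y, frobSq (S.Sig k y ω) ≤ CA
  frobSq_sub_le : ∀ k x y, frobSq (S.Sig k x ω - S.Sig k y ω) ≤ CA * ‖x - y‖
  frobSq_sub_le_sq : ∀ k x y, frobSq (S.Sig k x ω - S.Sig k y ω) ≤ CA * ‖x - y‖ ^ 2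
  coercive : ∀ k p r s y, |r| ≤ R →
    C₁ * ‖p‖ ^ S.γ k + C₂ * posMaxOff k s - C₃ ≤ S.H k p (fun _ => r) s y ω
  abs_le : ∀ ρ, 0 < ρ → ∀ k p r s y, ‖p‖ ≤ ρ → |r| ≤ R → (∀ j, |s j| ≤ ρ) →
    |S.H k p (fun _ => r) s y ω| ≤ C₄ ρ
  abs_sub_le : ∀ ρ, 0 < ρ → ∀ k p r₁ r₂ s₁ s₂ y₁ y₂, |r₁| ≤ R → |r₂| ≤ R →
    (∀ j, |s₁ j| ≤ ρ) → (∀ j, |s₂ j| ≤ ρ) →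
    |S.H k p (fun _ => r₁) s₁ y₁ ω - S.H k p (fun _ => r₂) s₂ y₂ ω| ≤
      C₅ ρ * (|r₁ - r₂| + ‖s₁ - s₂‖ + ‖y₁ - y₂‖)

theorem frobSq_le_of_abs_le {M : Matrix (Fin n) (Fin n) ℝ} {c : ℝ}
    (h : ∀ i j, M i j ^ 2 ≤ c) : frobSq M ≤ n * (n * c) := by
  unfold frobSq
  refine (Finset.sum_le_sum fun l _ => Finset.sum_le_sum fun i _ => h i l).trans (le_of_eq ?_)
  simp

theorem nonempty_cellBounds (S : Setting n m) (ω : S.Ω) {R : ℝ} (hR : 0 < R) :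
    Nonempty (CellBounds S ω R) := by
  obtain ⟨C, hC, hSig⟩ := S.Sig_lip
  obtain ⟨C₁, C₂, C₃, h₁, h₂, h₃, hco⟩ := S.coercive R hR
  have hb : ∀ ρ : ℝ, ∃ C₄ : ℝ, 0 ≤ C₄ ∧ (0 < ρ → ∀ k p r s y, ‖p‖ ≤ ρ → |r| ≤ R →
      (∀ j, |s j| ≤ ρ) → |S.H k p (fun _ => r) s y ω| ≤ C₄) := by
    intro ρ
    by_cases hρ : 0 < ρ
    · obtain ⟨C₄, h, h'⟩ := S.H_bounded (max ρ R) (lt_max_of_lt_left hρ)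
      refine ⟨C₄, h.le, fun _ k p r s y hp hr hs => h' k p _ s y ω (hp.trans (le_max_left _ _))
        ((pi_norm_const_le r).trans (hr.trans (le_max_right _ _)))
        ((pi_norm_le_iff_of_nonneg (by positivity)).2 fun j => (hs j).trans (le_max_left _ _))⟩
    · exact ⟨0, le_rfl, fun h => absurd h hρ⟩
  have hl : ∀ ρ : ℝ, ∃ C₅ : ℝ, 0 ≤ C₅ ∧ (0 < ρ → ∀ k p r₁ r₂ s₁ s₂ y₁ y₂, |r₁| ≤ R → |r₂| ≤ R →
      (∀ j, |s₁ j| ≤ ρ) → (∀ j, |s₂ j| ≤ ρ) →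
      |S.H k p (fun _ => r₁) s₁ y₁ ω - S.H k p (fun _ => r₂) s₂ y₂ ω| ≤
        C₅ * (|r₁ - r₂| + ‖s₁ - s₂‖ + ‖y₁ - y₂‖)) := by
    intro ρ
    by_cases hρ : 0 < ρ
    · obtain ⟨C₅, h, h'⟩ := S.H_cont (max ρ R) (lt_max_of_lt_left hρ)
      refine ⟨C₅, h.le, fun _ k p r₁ r₂ s₁ s₂ y₁ y₂ hr₁ hr₂ hs₁ hs₂ => ?_⟩
      have hr : ∀ r : ℝ, |r| ≤ R → ‖fun _ : Fin m => r‖ ≤ max ρ R := fun r hr =>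
        (pi_norm_const_le r).trans (hr.trans (le_max_right _ _))
      have hs : ∀ s : Fin m → ℝ, (∀ j, |s j| ≤ ρ) → ‖s‖ ≤ max ρ R := fun s hs =>
        (pi_norm_le_iff_of_nonneg (by positivity)).2 fun j => (hs j).trans (le_max_left _ _)
      have h3 := h' k p p (fun _ => r₁) (fun _ => r₂) s₁ s₂ y₁ y₂ ω (hr r₁ hr₁) (hr r₂ hr₂)
        (hs s₁ hs₁) (hs s₂ hs₂)
      refine h3.trans ?_
      have h4 : ‖(fun _ : Fin m => r₁) - fun _ => r₂‖ ≤ |r₁ - r₂| := pi_norm_const_le (r₁ - r₂)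
      rw [sub_self p, norm_zero, mul_zero, zero_add]
      gcongr
    · exact ⟨0, le_rfl, fun h => absurd h hρ⟩
  choose C₄ hC₄ hb using hb
  choose C₅ hC₅ hl using hl
  have hn : (0 : ℝ) ≤ n * (n * C ^ 2) := by positivity
  refine ⟨⟨n * (n * (2 * C ^ 2)), C₁, C₂, C₃, C₄, C₅, hR, by positivity, h₁, h₂, h₃, hC₄, hC₅,
    fun k y => frobSq_le_of_abs_le fun i j => ?_, fun k x y => ?_, fun k x y => ?_,
    fun k p r s y hr => hco k p _ s y ω ((pi_norm_const_le r).trans hr), hb, hl⟩⟩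
  · have := (hSig k ω i j).1 y
    rw [← sq_abs]
    nlinarith [abs_nonneg (S.Sig k y ω i j)]
  · have : (n : ℝ) * (n * (2 * C ^ 2)) * ‖x - y‖ = n * (n * (2 * C ^ 2 * ‖x - y‖)) := by ring
    rw [this]
    refine frobSq_le_of_abs_le fun i j => ?_
    have h1 := (hSig k ω i j).1 x
    have h2 := (hSig k ω i j).1 y
    have h3 := (hSig k ω i j).2 x y
    have h4 := abs_sub (S.Sig k x ω i j) (S.Sig k y ω i j)
    rw [Matrix.sub_apply, ← sq_abs, sq]
    calc _ ≤ (C * ‖x - y‖) * (2 * C) := by gcongr; linarith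
      _ = _ := by ring
  · have : (n : ℝ) * (n * (2 * C ^ 2)) * ‖x - y‖ ^ 2 = n * (n * (2 * C ^ 2 * ‖x - y‖ ^ 2)) := by
      ring
    rw [this]
    refine frobSq_le_of_abs_le fun i j => ?_
    have h3 := (hSig k ω i j).2 x y
    rw [Matrix.sub_apply, ← sq_abs, sq]
    calc _ ≤ (C * ‖x - y‖) * (C * ‖x - y‖) := by gcongr
      _ ≤ _ := by nlinarith [sq_nonneg (C * ‖x - y‖)]

/-- Superlinear growth of powers with exponent larger than one. -/
theorem eventually_add_mul_lt_mul_rpow {γ C c : ℝ} (hγ : 1 < γ) (hC : 0 < C) (hc : 0 < c)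
    (R a b : ℝ) : ∀ᶠ T in atTop, a + b * T < C * (c * T - R) ^ γ := by
  have h1 : Tendsto (fun T : ℝ => c * T - R) atTop atTop :=
    tendsto_atTop_add_const_right _ (-R) (tendsto_id.const_mul_atTop hc)
  have h2 := (tendsto_rpow_atTop (sub_pos.2 hγ)).comp h1
  filter_upwards [h2.eventually_ge_atTop (2 * (|b| + 1) / (C * c)), h1.eventually_gt_atTop 0,
    eventually_gt_atTop (|a|), eventually_ge_atTop (2 * R / c)] with T h3 h4 h5 h6
  have e : (c * T - R) ^ γ = (c * T - R) ^ (γ - 1) * (c * T - R) := by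
    rw [← Real.rpow_add_one h4.ne']
    congr 1
    ring
  rw [e]
  have h3 : 2 * (|b| + 1) / (C * c) ≤ (c * T - R) ^ (γ - 1) := h3
  have h7 : c * T / 2 ≤ c * T - R := by
    rw [div_le_iff₀ hc] at h6
    linarith
  have hT : 0 < T := lt_of_le_of_lt (abs_nonneg a) h5
  calc a + b * T < T + |b| * T := by
        have := le_abs_self a
        have := mul_le_mul_of_nonneg_right (le_abs_self b) hT.le
        linarith
    _ = C * (2 * (|b| + 1) / (C * c) * (c * T / 2)) := by field_simp; ring
    _ ≤ _ := by gcongr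

end

section

variable {n m : ℕ} {S : Setting n (m + 1)} {ω : S.Ω} {R : ℝ} {p : Euc n} {r δ : ℝ}
  {v : Fin (m + 1) → Euc n → ℝ}

/-- The uniform bound for `δ v^δ`. -/
def CellBounds.B₀ (K : CellBounds S ω R) : ℝ := K.CA + K.C₃ + K.C₄ (R + 1)

theorem CellBounds.B₀_nonneg (K : CellBounds S ω R) : 0 ≤ K.B₀ := by
  have := K.CA_nonneg
  have := K.C₃_pos
  have := K.C₄_nonneg (R + 1)
  unfold B₀
  positivity

theorem CellBounds.mul_rpow_nonneg (K : CellBounds S ω R) (k : Fin (m + 1)) (p : Euc n) :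
    0 ≤ K.C₁ * ‖p‖ ^ S.γ k :=
  mul_nonneg K.C₁_pos.le (Real.rpow_nonneg (norm_nonneg _) _)

theorem IsMacroSoln.exists_bound (hv : IsMacroSoln S p r δ ω v) :
    ∃ B : ℝ, 0 ≤ B ∧ ∀ k y, |v k y| ≤ B := by
  obtain ⟨B, hB⟩ := hv.2.1
  exact ⟨B, (abs_nonneg _).trans (hB 0 0), hB⟩

theorem IsMacroSoln.exists_lipschitz (hv : IsMacroSoln S p r δ ω v) :
    ∃ L : ℝ, 0 ≤ L ∧ ∀ k x y, |v k x - v k y| ≤ L * ‖x - y‖ := by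
  obtain ⟨L, hL⟩ := hv.2.2.1
  refine ⟨L, L.2, fun k x y => ?_⟩
  rw [← Real.dist_eq, ← dist_eq_norm]
  exact (hL k).dist_le_mul x y

theorem IsMacroSoln.mul_le (hv : IsMacroSoln S p r δ ω v) (K : CellBounds S ω R) (hδ : 0 < δ)
    (hr : |r| ≤ R) (k : Fin (m + 1)) (y₁ : Euc n) : δ * v k y₁ ≤ K.CA + K.C₃ := by
  obtain ⟨B, hB0, hB⟩ := hv.exists_bound
  have hc := hv.1 k
  obtain ⟨x, hx⟩ := exists_max_of_le_quadratic (g := fun y => v k y - 1 / 2 * ‖y - y₁‖ ^ 2)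
    (by fun_prop) (C := B) (c := 0) (ν := 1 / 2) (z := y₁) le_rfl (by norm_num)
    fun y => by linarith [(abs_le.1 (hB k y)).2]
  have h1 := hv.2.2.2.1.le_of_max_sub_sq (c := 1) hx
  have h2 := K.coercive k (p + (1 : ℝ) • (x - y₁)) r (fun j => v k x - v j x) x hr
  have h3 := K.mul_rpow_nonneg k (p + (1 : ℝ) • (x - y₁))
  have h4 := mul_nonneg K.C₂_pos.le (posMaxOff_nonneg k fun j => v k x - v j x)
  have h5 := K.frobSq_le k x
  have h6 := hx y₁
  simp only [sub_self, norm_zero] at h6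
  have h7 : v k y₁ ≤ v k x := by nlinarith [sq_nonneg ‖x - y₁‖]
  have h8 := mul_le_mul_of_nonneg_left h7 hδ.le
  linarith

theorem IsMacroSoln.le_mul (hv : IsMacroSoln S p r δ ω v) (K : CellBounds S ω R) (hδ : 0 < δ)
    (hp : ‖p‖ ≤ R) (hr : |r| ≤ R) (j : Fin (m + 1)) (y₁ : Euc n) :
    -(K.CA + K.C₄ (R + 1)) ≤ δ * v j y₁ := by
  obtain ⟨B, hB0, hB⟩ := hv.exists_bound
  have hc := hv.1
  have hR := K.R_pos
  set ν : ℝ := 1 / (4 * B + 1) with hνdef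
  have hν : 0 < ν := by positivity
  have hν1 : ν ≤ 1 := by
    rw [hνdef, div_le_one (by positivity)]
    linarith
  have hνB : 4 * B * ν ≤ 1 := by
    rw [hνdef, mul_one_div, div_le_one (by positivity)]
    linarith
  obtain ⟨k, x, hx⟩ := exists_max_index (g := fun k y => -v k y - ν / 2 * ‖y - y₁‖ ^ 2) fun k =>
    exists_max_of_le_quadratic (by fun_prop) (C := B) (c := 0) (ν := ν / 2) (z := y₁) le_rfl
      (by positivity) fun y => by linarith [(abs_le.1 (hB k y)).1]
  have h1 := hv.2.2.2.2.le_of_min_add_sq (k := k) (c := ν) (x := x) (y₁ := y₁)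
    fun y => by linarith [hx k y]
  have h2 : S.H k (p - ν • (x - y₁)) (fun _ => r) (fun j => v k x - v j x) x ω ≤
      S.H k (p - ν • (x - y₁)) (fun _ => r) 0 x ω :=
    S.H_monotone_s k _ _ x ω fun i => by
      change v k x - v i x ≤ 0
      linarith [hx i x]
  have h3 : ‖ν • (x - y₁)‖ ≤ 1 := by
    have h4 := hx k y₁
    simp only [sub_self, norm_zero] at h4
    have h5 := (abs_le.1 (hB k y₁)).2
    have h6 := (abs_le.1 (hB k x)).1
    rw [norm_smul, Real.norm_of_nonneg hν.le]
    refine (abs_le_of_sq_le_sq' ?_ zero_le_one).2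
    have : ν * (ν * ‖x - y₁‖ ^ 2) ≤ ν * (4 * B) :=
      mul_le_mul_of_nonneg_left (by linarith) hν.le
    linarith
  have h4 := (abs_le.1 (K.abs_le (R + 1) (by positivity) k (p - ν • (x - y₁)) r 0 x
    (by linarith [norm_sub_le p (ν • (x - y₁))]) hr (fun j => by simp; positivity))).2
  have h5 := K.frobSq_le k x
  have h5' : ν * frobSq (S.Sig k x ω) ≤ 1 * K.CA :=
    mul_le_mul hν1 h5 (frobSq_nonneg _) zero_le_one
  have h6 := hx j y₁
  simp only [sub_self, norm_zero] at h6
  have h7 : v k x ≤ v j y₁ := by nlinarith [sq_nonneg ‖x - y₁‖]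
  have h8 := mul_le_mul_of_nonneg_left h7 hδ.le
  linarith

theorem IsMacroSoln.abs_mul_le (hv : IsMacroSoln S p r δ ω v) (K : CellBounds S ω R) (hδ : 0 < δ)
    (hp : ‖p‖ ≤ R) (hr : |r| ≤ R) (k : Fin (m + 1)) (y : Euc n) : |δ * v k y| ≤ K.B₀ := by
  have h1 := hv.mul_le K hδ hr k y
  have h2 := hv.le_mul K hδ hp hr k y
  have := K.C₃_pos
  have := K.C₄_nonneg (R + 1)
  unfold CellBounds.B₀
  exact abs_le.2 ⟨by linarith, by linarith⟩

/-- The square root of `c + s` lies below its tangent. -/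
theorem sqrt_le_add_div {c s s₀ : ℝ} (hc : 0 < c) (hs : 0 ≤ s) (hs₀ : 0 ≤ s₀) :
    √(c + s) ≤ √(c + s₀) + (s - s₀) / (2 * √(c + s₀)) := by
  have h0 : 0 < √(c + s₀) := Real.sqrt_pos.2 (by positivity)
  have h1 : √(c + s₀) ^ 2 = c + s₀ := Real.sq_sqrt (by positivity)
  have h2 : √(c + s) ^ 2 = c + s := Real.sq_sqrt (by positivity)
  have : √(c + s₀) + (s - s₀) / (2 * √(c + s₀)) - √(c + s) =
      (√(c + s) - √(c + s₀)) ^ 2 / (2 * √(c + s₀)) := by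
    have : s - s₀ = √(c + s) ^ 2 - √(c + s₀) ^ 2 := by rw [h1, h2]; ring
    rw [this]
    field_simp
    ring
  have h3 : 0 ≤ (√(c + s) - √(c + s₀)) ^ 2 / (2 * √(c + s₀)) := by positivity
  linarith

theorem mul_sqrt_le_add {a c s s₀ : ℝ} (ha : 0 ≤ a) (hc : 0 < c) (hs : 0 ≤ s) (hs₀ : 0 ≤ s₀) :
    a * √(c + s) ≤ a * √(c + s₀) + (a / √(c + s₀) / 2 * s - a / √(c + s₀) / 2 * s₀) := by
  refine (mul_le_mul_of_nonneg_left (sqrt_le_add_div hc hs hs₀) ha).trans_eq ?_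
  have h0 : 0 < √(c + s₀) := Real.sqrt_pos.2 (by positivity)
  field_simp

theorem norm_le_sqrt_add {E : Type*} [NormedAddCommGroup E] {c : ℝ} (hc : 0 ≤ c) (x : E) :
    ‖x‖ ≤ √(c + ‖x‖ ^ 2) :=
  Real.le_sqrt_of_sq_le (by linarith)

theorem sqrt_sq_add_le {E : Type*} [NormedAddCommGroup E] {κ : ℝ} (hκ : 0 ≤ κ) (x : E) :
    √(κ ^ 2 + ‖x‖ ^ 2) ≤ κ + ‖x‖ :=
  Real.sqrt_le_iff.2 ⟨by positivity, by nlinarith [norm_nonneg x]⟩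

theorem le_sqrt_sq_add {E : Type*} [NormedAddCommGroup E] {κ : ℝ} (x : E) :
    κ ≤ √(κ ^ 2 + ‖x‖ ^ 2) :=
  Real.le_sqrt_of_sq_le (by nlinarith [norm_nonneg x])

/-- The uniform constant controlling the differences of the components at suitable points. -/
def CellBounds.C₇ (K : CellBounds S ω R) (K₀ : ℝ) : ℝ := (K.C₃ + K.B₀ + K₀ * K.CA) / K.C₂

theorem CellBounds.C₇_nonneg (K : CellBounds S ω R) {K₀ : ℝ} (hK₀ : 0 ≤ K₀) : 0 ≤ K.C₇ K₀ := by
  have := K.CA_nonneg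
  have := K.C₃_pos
  have := K.C₂_pos
  have := K.B₀_nonneg
  unfold C₇
  positivity

theorem IsMacroSoln.exists_near_le (hv : IsMacroSoln S p r δ ω v) (K : CellBounds S ω R)
    (hδ : 0 < δ) (hp : ‖p‖ ≤ R) (hr : |r| ≤ R) {K₀ : ℝ} (hK₀ : 0 < K₀)
    (hKR : 0 ≤ K₀ / 2 - R)
    (hK : ∀ k, K.C₃ + K.B₀ + K₀ * K.CA < K.C₁ * (K₀ / 2 - R) ^ S.γ k) (y₀ : Euc n) :
    ∃ z, ‖z - y₀‖ ≤ 1 ∧ ∀ k j x, v k x ≤ v j z + K.C₇ K₀ + K₀ * ‖x - y₀‖ := by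
  obtain ⟨B, hB0, hB⟩ := hv.exists_bound
  have hc := hv.1
  obtain ⟨k, z, hz⟩ := exists_max_index
    (g := fun k x => v k x - K₀ * √(1 ^ 2 + ‖x - y₀‖ ^ 2)) fun k =>
    exists_max_of_le_linear (by fun_prop) hK₀ (C := B + K₀ * ‖y₀‖) fun x => by
      have h1 := norm_le_sqrt_add (c := 1 ^ 2) (by norm_num) (x - y₀)
      have h2 := norm_sub_norm_le x y₀
      have h3 := mul_le_mul_of_nonneg_left (h2.trans h1) hK₀.le
      linarith [(abs_le.1 (hB k x)).2]
  set Z := √(1 ^ 2 + ‖z - y₀‖ ^ 2) with hZ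
  have hZ1 : 1 ≤ Z := le_sqrt_sq_add _
  have hZ0 : 0 < Z := by linarith
  have hZle : Z ≤ 1 + ‖z - y₀‖ := sqrt_sq_add_le zero_le_one _
  have h1 := hv.2.2.2.1.le_of_max_sub_sq (k := k) (c := K₀ / Z) (x := z) (y₁ := y₀) fun x => by
    have h2 : v k x - K₀ * √(1 ^ 2 + ‖x - y₀‖ ^ 2) ≤ v k z - K₀ * Z := hz k x
    have h4 := mul_sqrt_le_add (c := 1 ^ 2) (s := ‖x - y₀‖ ^ 2) (s₀ := ‖z - y₀‖ ^ 2) hK₀.le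
      (by norm_num) (by positivity) (by positivity)
    rw [← hZ] at h4
    clear_value Z
    generalize K₀ * √(1 ^ 2 + ‖x - y₀‖ ^ 2) = s at h2 h4
    generalize K₀ / Z / 2 * ‖x - y₀‖ ^ 2 = s₁ at h4 ⊢
    generalize K₀ / Z / 2 * ‖z - y₀‖ ^ 2 = s₂ at h4 ⊢
    linarith
  have h2 := K.coercive k (p + (K₀ / Z) • (z - y₀)) r (fun j => v k z - v j z) z hr
  have h3 := K.mul_rpow_nonneg k (p + (K₀ / Z) • (z - y₀))
  have h4 := mul_nonneg K.C₂_pos.le (posMaxOff_nonneg k fun j => v k z - v j z)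
  have h5 : K₀ / Z * frobSq (S.Sig k z ω) ≤ K₀ * K.CA :=
    mul_le_mul (div_le_self hK₀.le hZ1) (K.frobSq_le k z) (frobSq_nonneg _) hK₀.le
  have h6 := (abs_le.1 (hv.abs_mul_le K hδ hp hr k z)).1
  refine ⟨z, ?_, fun k' j x => ?_⟩
  · by_contra! hlt
    have h7 : K₀ / 2 - R ≤ ‖p + (K₀ / Z) • (z - y₀)‖ := by
      have h8 := norm_sub_le (p + (K₀ / Z) • (z - y₀)) p
      rw [add_sub_cancel_left, norm_smul, Real.norm_of_nonneg (by positivity)] at h8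
      have h9 : K₀ / 2 ≤ K₀ / Z * ‖z - y₀‖ := by
        rw [div_mul_eq_mul_div, div_le_div_iff₀ two_pos hZ0]
        nlinarith
      linarith
    have h8 := Real.rpow_le_rpow hKR h7 (by linarith [S.γ_gt_one k] : 0 ≤ S.γ k)
    have h9 := mul_le_mul_of_nonneg_left h8 K.C₁_pos.le
    linarith [hK k]
  · have h7 : v k z - v j z ≤ K.C₇ K₀ := by
      have h8 := le_posMaxOff (k := k) (s := fun j => v k z - v j z) (sub_self _) j
      have h9 : K.C₂ * (v k z - v j z) ≤ K.C₃ + K.B₀ + K₀ * K.CA := by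
        have := mul_le_mul_of_nonneg_left h8 K.C₂_pos.le
        linarith
      rw [CellBounds.C₇, le_div_iff₀ K.C₂_pos]
      linarith
    have h8 := hz k' x
    have h9 := sqrt_sq_add_le zero_le_one (x - y₀)
    have h10 := mul_le_mul_of_nonneg_left h9 hK₀.le
    have h11 := mul_le_mul_of_nonneg_left hZ1 hK₀.le
    have h8 : v k' x - K₀ * √(1 ^ 2 + ‖x - y₀‖ ^ 2) ≤ v k z - K₀ * Z := h8
    linarith

end

section

variable {n m : ℕ} {S : Setting n (m + 1)} {ω : S.Ω}

theorem columnTrace_smul (M : Matrix (Fin n) (Fin n) ℝ) (c : ℝ) (T : Euc n →L[ℝ] Euc n) :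
    columnTrace M (c • T) = c * columnTrace M T := by
  rw [columnTrace, columnTrace, Finset.mul_sum]
  refine Finset.sum_congr rfl fun l _ => ?_
  rw [_root_.smul_apply, real_inner_smul_left]

theorem IsViscSubOn.mul_le_columnTrace {p : Euc n} {r δ : ℝ} {v : Fin (m + 1) → Euc n → ℝ}
    {k : Fin (m + 1)} (hv : IsViscSubOn (macroOp S p r δ ω) Set.univ v) {c : ℝ} (hc : 0 < c)
    {x q : Euc n} {T : Euc n →L[ℝ] Euc n}
    (h : ∀ᶠ h in 𝓝 (0 : Euc n),
      c * v k (x + h) ≤ c * v k x + inner ℝ q h + 1 / 2 * inner ℝ (T h) h) :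
    c * (δ * v k x + S.H k (p + c⁻¹ • q) (fun _ => r) (fun j => v k x - v j x) x ω) ≤
      columnTrace (S.Sig k x ω) T := by
  have h1 := hv.le_columnTrace (k := k) (x := x) (q := c⁻¹ • q) (T := c⁻¹ • T) (by
    filter_upwards [h] with z hz
    rw [_root_.smul_apply, real_inner_smul_left, real_inner_smul_left]
    refine le_of_mul_le_mul_left (hz.trans_eq ?_) hc
    field_simp)
  rw [columnTrace_smul] at h1
  refine (mul_le_mul_of_nonneg_left h1 hc.le).trans_eq ?_
  rw [mul_inv_cancel_left₀ hc.ne']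

theorem continuous_macro_hamiltonian {v : Fin (m + 1) → Euc n → ℝ} (hv : ∀ k, Continuous (v k))
    (k : Fin (m + 1)) (p : Euc n) (r δ c : ℝ) :
    Continuous fun z : Euc n × Euc n =>
      δ * v k z.1 + S.H k (p + c • z.2) (fun _ => r) (fun j => v k z.1 - v j z.1) z.1 ω := by
  have h1 : Continuous fun z : Euc n × Euc n =>
      ((p + c • z.2, (fun j => v k z.1 - v j z.1), z.1) : Euc n × (Fin (m + 1) → ℝ) × Euc n) :=
    (by fun_prop : Continuous fun z : Euc n × Euc n => p + c • z.2).prodMk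
      ((continuous_pi fun j => ((hv k).comp continuous_fst).sub
        ((hv j).comp continuous_fst)).prodMk continuous_fst)
  exact (continuous_const.mul ((hv k).comp continuous_fst)).add
    ((S.continuous_H k (fun _ => r) ω).comp h1)

/-- Doubling of variables for two solutions of macroscopic systems. -/
theorem IsMacroSoln.sub_le_of_max {p₁ p₂ : Euc n} {r₁ r₂ δ : ℝ}
    {v₁ v₂ : Fin (m + 1) → Euc n → ℝ} (hv₁ : IsMacroSoln S p₁ r₁ δ ω v₁)
    (hv₂ : IsMacroSoln S p₂ r₂ δ ω v₂) {c α β : ℝ} (hc : 0 < c) (hα : 0 ≤ α) (hβ : 0 ≤ β)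
    {k : Fin (m + 1)} {x₀ y₀ y₁ : Euc n}
    (hmax : ∀ x y, c * v₁ k x - v₂ k y - (α / 2 * ‖x - y‖ ^ 2 + β / 2 * ‖y - y₁‖ ^ 2) ≤
      c * v₁ k x₀ - v₂ k y₀ - (α / 2 * ‖x₀ - y₀‖ ^ 2 + β / 2 * ‖y₀ - y₁‖ ^ 2)) :
    c * (δ * v₁ k x₀ + S.H k (p₁ + c⁻¹ • α • (x₀ - y₀)) (fun _ => r₁)
        (fun j => v₁ k x₀ - v₁ j x₀) x₀ ω) -
      (δ * v₂ k y₀ + S.H k (p₂ + (1 : ℝ) • (α • (x₀ - y₀) - β • (y₀ - y₁))) (fun _ => r₂)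
        (fun j => v₂ k y₀ - v₂ j y₀) y₀ ω) ≤
      α * frobSq (S.Sig k x₀ ω - S.Sig k y₀ ω) + β * frobSq (S.Sig k y₀ ω) := by
  obtain ⟨B₁, hB₁0, hB₁⟩ := hv₁.exists_bound
  obtain ⟨B₂, hB₂0, hB₂⟩ := hv₂.exists_bound
  obtain ⟨L₁, hL₁0, hL₁⟩ := hv₁.exists_lipschitz
  obtain ⟨L₂, hL₂0, hL₂⟩ := hv₂.exists_lipschitz
  have hSig : ∀ i j, Continuous fun x => S.Sig k x ω i j := by
    intro i j
    obtain ⟨C, hC, hS⟩ := S.Sig_lip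
    refine (LipschitzWith.of_dist_le_mul (K := C.toNNReal) fun x y => ?_).continuous
    rw [Real.dist_eq, dist_eq_norm, Real.coe_toNNReal _ hC.le]
    exact (hS k ω i j).2 x y
  refine jets_sub_le_of_max (u := fun x => c * v₁ k x) (w := v₂ k) (B := c * B₁ + B₂)
    (L := c * L₁ + L₂) (Sig := fun x => S.Sig k x ω)
    (a := fun x q => c * (δ * v₁ k x + S.H k (p₁ + c⁻¹ • q) (fun _ => r₁)
      (fun j => v₁ k x - v₁ j x) x ω))
    (b := fun y q => δ * v₂ k y + S.H k (p₂ + (1 : ℝ) • q) (fun _ => r₂)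
      (fun j => v₂ k y - v₂ j y) y ω) hSig
    (continuous_const.mul (continuous_macro_hamiltonian hv₁.1 k p₁ r₁ δ c⁻¹))
    (continuous_macro_hamiltonian hv₂.1 k p₂ r₂ δ 1) (fun x => ?_) (fun x => ?_) (by positivity)
    (fun x y => ?_) (fun x y => ?_) hα hβ (fun x q T h => hv₁.2.2.2.1.mul_le_columnTrace hc h)
    (fun y q T h => ?_) hmax
  · rw [abs_mul, abs_of_pos hc]
    have := mul_le_mul_of_nonneg_left (hB₁ k x) hc.le
    linarith
  · have := hB₂ k x
    have : 0 ≤ c * B₁ := by positivity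
    linarith
  · rw [← mul_sub, abs_mul, abs_of_pos hc]
    have := mul_le_mul_of_nonneg_left (hL₁ k x y) hc.le
    have : 0 ≤ L₂ * ‖x - y‖ := by positivity
    linarith
  · have := hL₂ k x y
    have : 0 ≤ c * L₁ * ‖x - y‖ := by positivity
    linarith
  · simp only [one_smul]
    exact hv₂.2.2.2.2.columnTrace_le h

end

section

variable {n m : ℕ} {S : Setting n (m + 1)} {ω : S.Ω} {R : ℝ} {p : Euc n} {r δ : ℝ}
  {v : Fin (m + 1) → Euc n → ℝ}

theorem IsMacroSoln.exists_gap (hv : IsMacroSoln S p r δ ω v) {C K₀ : ℝ}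
    (hnear : ∀ y₀, ∃ z, ‖z - y₀‖ ≤ 1 ∧ ∀ k j x, v k x ≤ v j z + C + K₀ * ‖x - y₀‖) :
    ∃ D : ℝ, (∀ k j x y, v k x ≤ v j y + (D + C + K₀ * ‖x - y‖)) ∧
      ∃ x₀ y₀ j₀, ‖x₀ - y₀‖ ≤ 1 ∧ ∀ i, D - 1 ≤ v i x₀ - v j₀ y₀ := by
  obtain ⟨B, hB0, hB⟩ := hv.exists_bound
  set G : Set ℝ := {t | ∃ x y, ‖x - y‖ ≤ 1 ∧ ∃ j, ∀ i, t ≤ v i x - v j y} with hG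
  have hne : G.Nonempty := ⟨-(2 * B), 0, 0, by simp, 0, fun i => by
    linarith [(abs_le.1 (hB i 0)).1, (abs_le.1 (hB 0 0)).2]⟩
  have hbdd : BddAbove G := ⟨2 * B, by
    rintro t ⟨x, y, -, j, hj⟩
    linarith [hj 0, (abs_le.1 (hB 0 x)).2, (abs_le.1 (hB j y)).1]⟩
  refine ⟨sSup G, fun k j x y => ?_, ?_⟩
  · obtain ⟨z, hz, hzle⟩ := hnear y
    obtain ⟨i, hi⟩ := Finite.exists_min fun i => v i z
    have h1 : v i z - v j y ≤ sSup G :=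
      le_csSup hbdd ⟨z, y, hz, j, fun i' => by linarith [hi i']⟩
    linarith [hzle k i x]
  · obtain ⟨t, ⟨x, y, hxy, j, hj⟩, ht⟩ := exists_lt_of_lt_csSup hne (sub_one_lt (sSup G))
    exact ⟨x, y, j, hxy, fun i => ht.le.trans (hj i)⟩

/-- The radius on which the Hamiltonians are evaluated in the bound for the gap. -/
def gapRadius (R C K₀ : ℝ) : ℝ := R + 3 * K₀ + (5 * K₀ + 2 * C + 4)

set_option maxHeartbeats 1000000 in
theorem IsMacroSoln.rpow_le_of_gap (hv : IsMacroSoln S p r δ ω v) (K : CellBounds S ω R)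
    (hδ : 0 < δ) (hp : ‖p‖ ≤ R) (hr : |r| ≤ R) {C K₀ D T : ℝ} (hC : 0 ≤ C) (hK₀ : 0 < K₀)
    (hKR : R ≤ K₀ / 2) (hT : 1 ≤ T) (hDT : D = 1 + (5 * K₀ + C + 3) * T)
    (hD : ∀ k j x y, v k x ≤ v j y + (D + C + K₀ * ‖x - y‖)) {x₀ y₀ : Euc n} {j₀ : Fin (m + 1)}
    (hxy₀ : ‖x₀ - y₀‖ ≤ 1) (hgap : ∀ i, D - 1 ≤ v i x₀ - v j₀ y₀) :
    ∃ k, K.C₁ * (K₀ / 2 * T - R) ^ S.γ k ≤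
      (K.B₀ + K.C₃) + (K.B₀ + K.C₄ (gapRadius R C K₀) + 3 * K₀ * K.CA) * T := by
  obtain ⟨B, hB0, hB⟩ := hv.exists_bound
  obtain ⟨L, hL0, hL⟩ := hv.exists_lipschitz
  have hc := hv.1
  have hT0 : 0 < T := by linarith
  set Q := 5 * K₀ + C + 3 with hQ
  set ε := T⁻¹ with hε
  have hε0 : 0 < ε := inv_pos.2 hT0
  have hε1 : ε ≤ 1 := inv_le_one_of_one_le₀ hT
  have hεD : ε * D = ε + Q := by
    rw [hDT, hε]
    field_simp
  set κ := (L + 1)⁻¹ with hκ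
  have hκ0 : 0 < κ := by positivity
  have hκ1 : κ ≤ 1 := inv_le_one_of_one_le₀ (by linarith)
  have hLκ : L * κ ≤ 1 := by
    rw [hκ, ← div_eq_mul_inv, div_le_one (by positivity)]
    linarith
  obtain ⟨k, ⟨a, b⟩, hmax⟩ := exists_max_index
    (g := fun k (z : Euc n × Euc n) => ε * v k z.1 - v k z.2 -
      (K₀ * √(κ ^ 2 + ‖z.1 - z.2‖ ^ 2) + 2 * K₀ * √(1 ^ 2 + ‖z.2 - y₀‖ ^ 2))) fun k =>
    exists_max_of_le_linear (by fun_prop) hK₀ (C := 2 * B + 2 * K₀ * ‖y₀‖) fun z => by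
      have h1 := norm_le_sqrt_add (c := κ ^ 2) (by positivity) (z.1 - z.2)
      have h2 := norm_le_sqrt_add (c := 1 ^ 2) (by positivity) (z.2 - y₀)
      have h3 := mul_le_mul_of_nonneg_left ((norm_sub_norm_le z.1 z.2).trans h1) hK₀.le
      have h4 := mul_le_mul_of_nonneg_left ((norm_sub_norm_le z.2 y₀).trans h2) hK₀.le
      have h5 : ‖z‖ ≤ ‖z.1‖ + ‖z.2‖ :=
        max_le_add_of_nonneg (norm_nonneg _) (norm_nonneg _)
      have h6 := mul_le_mul_of_nonneg_left h5 hK₀.le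
      have h7 : ε * v k z.1 ≤ 1 * B := (mul_le_mul_of_nonneg_left (abs_le.1 (hB k z.1)).2
        hε0.le).trans (mul_le_mul_of_nonneg_right hε1 hB0)
      linarith [(abs_le.1 (hB k z.2)).1]
  have hmax : ∀ j x y, ε * v j x - v j y -
      (K₀ * √(κ ^ 2 + ‖x - y‖ ^ 2) + 2 * K₀ * √(1 ^ 2 + ‖y - y₀‖ ^ 2)) ≤ ε * v k a - v k b -
      (K₀ * √(κ ^ 2 + ‖a - b‖ ^ 2) + 2 * K₀ * √(1 ^ 2 + ‖b - y₀‖ ^ 2)) :=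
    fun j x y => hmax j (x, y)
  set c₀ := v j₀ y₀ with hc₀
  have hlow : (ε - 1) * c₀ + Q - 4 * K₀ ≤ ε * v k a - v k b -
      (K₀ * √(κ ^ 2 + ‖a - b‖ ^ 2) + 2 * K₀ * √(1 ^ 2 + ‖b - y₀‖ ^ 2)) := by
    have h1 := hmax j₀ x₀ y₀
    have h2 : √(1 ^ 2 + ‖y₀ - y₀‖ ^ 2) = 1 := by simp
    have h3 : √(κ ^ 2 + ‖x₀ - y₀‖ ^ 2) ≤ 2 := by
      linarith [sqrt_sq_add_le hκ0.le (x₀ - y₀)]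
    have h4 := mul_le_mul_of_nonneg_left h3 hK₀.le
    have h5 := mul_le_mul_of_nonneg_left (hgap j₀) hε0.le
    rw [h2] at h1
    linarith
  have hκd : κ ≤ ‖a - b‖ := by
    by_contra! hlt
    have h1 : v k a ≤ v k b + 1 := by
      have := (abs_le.1 (hL k a b)).2
      have := mul_le_mul_of_nonneg_left hlt.le hL0
      linarith
    have h2 : c₀ - 1 - C - K₀ * (1 + ‖b - y₀‖) ≤ v k b := by
      have h3 := hD k k x₀ b
      have h4 := hgap k
      have h5 : ‖x₀ - b‖ ≤ 1 + ‖b - y₀‖ := by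
        have := norm_sub_le_norm_sub_add_norm_sub x₀ y₀ b
        rw [norm_sub_rev y₀ b] at this
        linarith
      have h6 := mul_le_mul_of_nonneg_left h5 hK₀.le
      linarith
    have h3 := mul_le_mul_of_nonneg_left h1 hε0.le
    have h4 := mul_le_mul_of_nonneg_left h2 (sub_nonneg.2 hε1)
    have h5 := mul_le_mul_of_nonneg_left
      (norm_le_sqrt_add (c := 1 ^ 2) (by positivity) (b - y₀)) hK₀.le
    have h6 : 0 ≤ K₀ * √(κ ^ 2 + ‖a - b‖ ^ 2) := by positivity
    have h7 : 0 ≤ ε * (1 + C + K₀ * (1 + ‖b - y₀‖)) := by positivity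
    have h8 : 0 ≤ K₀ * √(1 ^ 2 + ‖b - y₀‖ ^ 2) := by positivity
    nlinarith
  set Z₁ := √(κ ^ 2 + ‖a - b‖ ^ 2) with hZ₁
  set Z₂ := √(1 ^ 2 + ‖b - y₀‖ ^ 2) with hZ₂
  have hZ₁le : Z₁ ≤ 2 * ‖a - b‖ := by linarith [sqrt_sq_add_le hκ0.le (a - b)]
  have hZ₁ge : ‖a - b‖ ≤ Z₁ := norm_le_sqrt_add (by positivity) _
  have hZ₁0 : 0 < Z₁ := hκ0.trans_le (hκd.trans hZ₁ge)
  have hZ₂ge : ‖b - y₀‖ ≤ Z₂ := norm_le_sqrt_add (by positivity) _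
  have hZ₂1 : 1 ≤ Z₂ := le_sqrt_sq_add _
  have hZ₂0 : 0 < Z₂ := by linarith
  have hdouble := hv.sub_le_of_max hv hε0 (α := K₀ / Z₁) (β := 2 * K₀ / Z₂) (by positivity)
    (by positivity) (k := k) (x₀ := a) (y₀ := b) (y₁ := y₀) fun x y => by
    have h1 := hmax k x y
    have h2 := mul_sqrt_le_add (c := κ ^ 2) (s := ‖x - y‖ ^ 2) (s₀ := ‖a - b‖ ^ 2) hK₀.le
      (by positivity) (by positivity) (by positivity)
    have h3 := mul_sqrt_le_add (a := 2 * K₀) (c := 1 ^ 2) (s := ‖y - y₀‖ ^ 2)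
      (s₀ := ‖b - y₀‖ ^ 2) (by positivity) (by positivity) (by positivity) (by positivity)
    rw [← hZ₁] at h2
    rw [← hZ₂] at h3
    clear_value Z₁ Z₂
    generalize K₀ * √(κ ^ 2 + ‖x - y‖ ^ 2) = s at h1 h2
    generalize 2 * K₀ * √(1 ^ 2 + ‖y - y₀‖ ^ 2) = s' at h1 h3
    generalize K₀ / Z₁ / 2 * ‖x - y‖ ^ 2 = s₁ at h2 ⊢
    generalize K₀ / Z₁ / 2 * ‖a - b‖ ^ 2 = s₂ at h2 ⊢
    generalize 2 * K₀ / Z₂ / 2 * ‖y - y₀‖ ^ 2 = s₃ at h3 ⊢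
    generalize 2 * K₀ / Z₂ / 2 * ‖b - y₀‖ ^ 2 = s₄ at h3 ⊢
    linarith
  have hα : K₀ / Z₁ * ‖a - b‖ ≤ K₀ := by
    rw [div_mul_eq_mul_div, div_le_iff₀ hZ₁0]
    exact mul_le_mul_of_nonneg_left hZ₁ge hK₀.le
  have hα' : K₀ / 2 ≤ K₀ / Z₁ * ‖a - b‖ := by
    rw [div_mul_eq_mul_div, div_le_div_iff₀ two_pos hZ₁0]
    nlinarith
  have hβ : 2 * K₀ / Z₂ * ‖b - y₀‖ ≤ 2 * K₀ := by
    rw [div_mul_eq_mul_div, div_le_iff₀ hZ₂0]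
    exact mul_le_mul_of_nonneg_left hZ₂ge (by positivity)
  have hfrob₁ : K₀ / Z₁ * frobSq (S.Sig k a ω - S.Sig k b ω) ≤ K₀ * K.CA := by
    have h1 := mul_le_mul_of_nonneg_left (K.frobSq_sub_le k a b) (div_nonneg hK₀.le hZ₁0.le)
    have h2 := mul_le_mul_of_nonneg_right hα K.CA_nonneg
    linarith
  have hfrob₂ : 2 * K₀ / Z₂ * frobSq (S.Sig k b ω) ≤ 2 * K₀ * K.CA :=
    mul_le_mul (div_le_self (by positivity) hZ₂1) (K.frobSq_le k b) (frobSq_nonneg _)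
      (by positivity)
  set q := (K₀ / Z₁) • (a - b) with hq
  have hqnorm : ‖q‖ = K₀ / Z₁ * ‖a - b‖ := by
    rw [hq, norm_smul, Real.norm_of_nonneg (by positivity)]
  have hH₁ := K.coercive k (p + ε⁻¹ • q) r (fun j => v k a - v j a) a hr
  have hpos := mul_nonneg K.C₂_pos.le (posMaxOff_nonneg k fun j => v k a - v j a)
  have hH₂ : S.H k (p + (1 : ℝ) • (q - (2 * K₀ / Z₂) • (b - y₀))) (fun _ => r)
      (fun j => v k b - v j b) b ω ≤ K.C₄ (gapRadius R C K₀) := by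
    refine (S.H_monotone_s k _ _ b ω (b := fun _ => 5 * K₀ + 2 * C + 4) fun j => ?_).trans
      (abs_le.1 (K.abs_le _ ?_ k _ r _ b ?_ hr fun j => ?_)).2
    · have h1 := hmax j a b
      have h2 := hD k j a a
      rw [sub_self, norm_zero] at h2
      have h3 := mul_le_mul_of_nonneg_left h2 hε0.le
      have h4 : ε * C ≤ 1 * C := mul_le_mul_of_nonneg_right hε1 hC
      change v k b - v j b ≤ _
      linarith
    · have := K.R_pos
      unfold gapRadius
      positivity
    · rw [one_smul]
      have h1 := norm_add_le p (q - (2 * K₀ / Z₂) • (b - y₀))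
      have h2 := norm_sub_le q ((2 * K₀ / Z₂) • (b - y₀))
      have h3 : ‖(2 * K₀ / Z₂) • (b - y₀)‖ ≤ 2 * K₀ := by
        rwa [norm_smul, Real.norm_of_nonneg (by positivity)]
      unfold gapRadius
      linarith
    · rw [abs_of_nonneg (by positivity)]
      have := K.R_pos
      unfold gapRadius
      linarith
  have hB₁ := (abs_le.1 (hv.abs_mul_le K hδ hp hr k a)).1
  have hB₂ := (abs_le.1 (hv.abs_mul_le K hδ hp hr k b)).2
  have hnorm : K₀ / 2 * T - R ≤ ‖p + ε⁻¹ • q‖ := by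
    have h8 := norm_sub_le (p + ε⁻¹ • q) p
    rw [add_sub_cancel_left, norm_smul, hε, inv_inv, Real.norm_of_nonneg hT0.le, hqnorm] at h8
    rw [hε, inv_inv]
    have := mul_le_mul_of_nonneg_left hα' hT0.le
    linarith
  have hrpow := mul_le_mul_of_nonneg_left (Real.rpow_le_rpow (by nlinarith) hnorm
    (by linarith [S.γ_gt_one k] : 0 ≤ S.γ k)) K.C₁_pos.le
  refine ⟨k, ?_⟩
  have h1 : ε * (K.C₁ * (K₀ / 2 * T - R) ^ S.γ k - (K.B₀ + K.C₃)) ≤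
      K.B₀ + K.C₄ (gapRadius R C K₀) + 3 * K₀ * K.CA := by
    have := mul_le_mul_of_nonneg_left (a := ε)
      (show K.C₁ * (K₀ / 2 * T - R) ^ S.γ k - (K.B₀ + K.C₃) ≤ δ * v k a +
        S.H k (p + ε⁻¹ • q) (fun _ => r) (fun j => v k a - v j a) a ω by linarith) hε0.le
    linarith
  rw [hε, inv_mul_le_iff₀ hT0] at h1
  linarith

/-- The components of the solution stay within a bounded distance of each other, uniformly in the
parameters. -/
theorem CellBounds.exists_sub_le (K : CellBounds S ω R) :
    ∃ M : ℝ, 0 ≤ M ∧ ∀ (p : Euc n) (r δ : ℝ) (v : Fin (m + 1) → Euc n → ℝ), 0 < δ → ‖p‖ ≤ R →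
      |r| ≤ R → IsMacroSoln S p r δ ω v → ∀ k j y, v k y - v j y ≤ M := by
  have hR := K.R_pos
  obtain ⟨K₀, hK₀, hK₀R⟩ := ((eventually_all.2 fun k => eventually_add_mul_lt_mul_rpow
    (S.γ_gt_one k) K.C₁_pos one_half_pos R (K.C₃ + K.B₀) K.CA).and
    (eventually_ge_atTop (2 * R + 2))).exists
  set C := K.C₇ K₀ with hCdef
  have hC : 0 ≤ C := K.C₇_nonneg (by linarith)
  obtain ⟨T₀, hT₀⟩ := eventually_atTop.1 ((eventually_all.2 fun k =>
    eventually_add_mul_lt_mul_rpow (S.γ_gt_one k) K.C₁_pos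
    (show 0 < K₀ / 2 by linarith) R (K.B₀ + K.C₃)
    (K.B₀ + K.C₄ (gapRadius R C K₀) + 3 * K₀ * K.CA)).and (eventually_ge_atTop 1))
  have hT₀1 := (hT₀ T₀ le_rfl).2
  have hQ : 0 < 5 * K₀ + C + 3 := by linarith
  refine ⟨1 + (5 * K₀ + C + 3) * T₀ + C, by positivity, fun p r δ v hδ hp hr hv k j y => ?_⟩
  obtain ⟨D, hD, x₀, y₀, j₀, hxy₀, hgap⟩ := hv.exists_gap (C := C) (K₀ := K₀) fun y₀ =>
    hv.exists_near_le K hδ hp hr (by linarith) (by linarith) (fun k => by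
      have := hK₀ k
      rw [one_div_mul_eq_div] at this
      linarith) y₀
  have hD₀ : D ≤ 1 + (5 * K₀ + C + 3) * T₀ := by
    by_contra! hlt
    have hT : T₀ ≤ (D - 1) / (5 * K₀ + C + 3) := by
      rw [le_div_iff₀ hQ]
      linarith
    obtain ⟨i, hi⟩ := hv.rpow_le_of_gap K hδ hp hr hC (by linarith) (by linarith)
      (hT₀1.trans hT) (by field_simp; ring) hD hxy₀ hgap
    exact absurd hi (not_le.2 ((hT₀ _ hT).1 i))
  have := hD k j y y
  rw [sub_self, norm_zero] at this
  linarith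

end

section

variable {n m : ℕ} {S : Setting n (m + 1)} {ω : S.Ω} {R : ℝ}

theorem IsMacroSoln.mul_sub_le (K : CellBounds S ω R) {M : ℝ} (hM : 0 ≤ M) {p₁ p₂ : Euc n}
    {r₁ r₂ δ θ : ℝ} {v₁ v₂ : Fin (m + 1) → Euc n → ℝ} (hδ : 0 < δ) (hp₁ : ‖p₁‖ ≤ R)
    (hr₁ : |r₁| ≤ R) (hr₂ : |r₂| ≤ R) (hv₁ : IsMacroSoln S p₁ r₁ δ ω v₁)
    (hv₂ : IsMacroSoln S p₂ r₂ δ ω v₂) (hM₁ : ∀ k j y, v₁ k y - v₁ j y ≤ M)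
    (hθ : ‖p₁ - p₂‖ ≤ θ) (hθ0 : 0 < θ) (hθ1 : θ < 1) (k₁ : Fin (m + 1)) (y₁ : Euc n) :
    δ * ((1 - θ) * v₁ k₁ y₁ - v₂ k₁ y₁) ≤
      (K.C₄ (R + 2 + M) + K.C₅ (R + M) * (1 + M) + 2) * (θ + |r₁ - r₂|) := by
  obtain ⟨B₁, hB₁0, hB₁⟩ := hv₁.exists_bound
  obtain ⟨B₂, hB₂0, hB₂⟩ := hv₂.exists_bound
  obtain ⟨L, hL0, hL⟩ := hv₁.exists_lipschitz
  have hc₁ := hv₁.1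
  have hc₂ := hv₂.1
  have hR := K.R_pos
  have hCA := K.CA_nonneg
  have hC₄ := K.C₄_nonneg (R + 2 + M)
  have hC₅ := K.C₅_nonneg (R + M)
  set c := 1 - θ with hc
  have hc0 : 0 < c := by linarith
  have hc1 : c ≤ 1 := by linarith
  set α := (2 * L * K.C₅ (R + M) + 4 * L ^ 2 * K.CA + 1) / θ with hα
  have hα0 : 0 < α := by positivity
  set ν := θ ^ 2 / (4 * (B₁ + B₂) + K.CA + 1) with hν
  have hν0 : 0 < ν := by positivity
  have hνθ : ν * (4 * (B₁ + B₂) + K.CA + 1) = θ ^ 2 := by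
    rw [hν]
    field_simp
  have hcv₁ : ∀ k x, |c * v₁ k x| ≤ B₁ := fun k x => by
    rw [abs_mul, abs_of_pos hc0]
    exact (mul_le_of_le_one_left (abs_nonneg _) hc1).trans (hB₁ k x)
  obtain ⟨k, ⟨a, b⟩, hmax⟩ := exists_max_index
    (g := fun k (z : Euc n × Euc n) => c * v₁ k z.1 - v₂ k z.2 -
      (α / 2 * ‖z.1 - z.2‖ ^ 2 + ν / 2 * ‖z.2 - y₁‖ ^ 2)) fun k =>
    exists_max_of_le_linear (by fun_prop) one_pos
      (C := B₁ + B₂ + 1 / (2 * α) + 2 / ν + 2 * ‖y₁‖) fun z => by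
      have h1 : ‖z‖ ≤ ‖z.1‖ + ‖z.2‖ :=
        max_le_add_of_nonneg (norm_nonneg _) (norm_nonneg _)
      have h2 := norm_sub_norm_le z.1 z.2
      have h3 := norm_sub_norm_le z.2 y₁
      have h4 : ‖z.1 - z.2‖ ≤ 1 / (2 * α) + α / 2 * ‖z.1 - z.2‖ ^ 2 := by
        have : 1 / (2 * α) + α / 2 * ‖z.1 - z.2‖ ^ 2 - ‖z.1 - z.2‖ =
            (α * ‖z.1 - z.2‖ - 1) ^ 2 / (2 * α) := by
          field_simp
          ring
        have : 0 ≤ (α * ‖z.1 - z.2‖ - 1) ^ 2 / (2 * α) := by positivity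
        linarith
      have h5 : 2 * ‖z.2 - y₁‖ ≤ 2 / ν + ν / 2 * ‖z.2 - y₁‖ ^ 2 := by
        have : 2 / ν + ν / 2 * ‖z.2 - y₁‖ ^ 2 - 2 * ‖z.2 - y₁‖ =
            (ν * ‖z.2 - y₁‖ - 2) ^ 2 / (2 * ν) := by
          field_simp
          ring
        have : 0 ≤ (ν * ‖z.2 - y₁‖ - 2) ^ 2 / (2 * ν) := by positivity
        linarith
      linarith [(abs_le.1 (hcv₁ k z.1)).2, (abs_le.1 (hB₂ k z.2)).1]
  have hmax : ∀ j x y, c * v₁ j x - v₂ j y - (α / 2 * ‖x - y‖ ^ 2 + ν / 2 * ‖y - y₁‖ ^ 2) ≤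
      c * v₁ k a - v₂ k b - (α / 2 * ‖a - b‖ ^ 2 + ν / 2 * ‖b - y₁‖ ^ 2) :=
    fun j x y => hmax j (x, y)
  have hd : α * ‖a - b‖ ≤ 2 * L := by
    by_contra! hlt
    have h1 := hmax k b b
    rw [sub_self, norm_zero] at h1
    have h2 := mul_le_mul_of_nonneg_left (abs_le.1 (hL k a b)).2 hc0.le
    have h3 : c * (L * ‖a - b‖) ≤ L * ‖a - b‖ := mul_le_of_le_one_left (by positivity) hc1
    have h4 : 0 < ‖a - b‖ := by
      by_contra! hle
      have := mul_le_mul_of_nonneg_left hle hα0.le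
      linarith
    nlinarith
  have hbase : c * v₁ k₁ y₁ - v₂ k₁ y₁ ≤
      c * v₁ k a - v₂ k b - (α / 2 * ‖a - b‖ ^ 2 + ν / 2 * ‖b - y₁‖ ^ 2) := by
    simpa using hmax k₁ y₁ y₁
  have hαd : 0 ≤ α / 2 * ‖a - b‖ ^ 2 := by positivity
  have hνd : 0 ≤ ν / 2 * ‖b - y₁‖ ^ 2 := by positivity
  have hνnorm : ‖ν • (b - y₁)‖ ≤ θ := by
    rw [norm_smul, Real.norm_of_nonneg hν0.le]
    refine (abs_le_of_sq_le_sq' ?_ hθ0.le).2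
    have h1 : ν * ‖b - y₁‖ ^ 2 ≤ 4 * (B₁ + B₂) := by
      linarith [(abs_le.1 (hcv₁ k a)).2, (abs_le.1 (hB₂ k b)).1, (abs_le.1 (hcv₁ k₁ y₁)).1,
        (abs_le.1 (hB₂ k₁ y₁)).2]
    have h2 := mul_le_mul_of_nonneg_left h1 hν0.le
    have h3 : 0 ≤ ν * (K.CA + 1) := by positivity
    linarith
  have herr : K.C₅ (R + M) * ‖a - b‖ + α * (K.CA * ‖a - b‖ ^ 2) ≤ θ := by
    have h1 : α * θ = 2 * L * K.C₅ (R + M) + 4 * L ^ 2 * K.CA + 1 := by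
      rw [hα]
      field_simp
    have h2 := mul_le_mul_of_nonneg_left hd hC₅
    have h3 := mul_le_mul_of_nonneg_left (pow_le_pow_left₀ (by positivity) hd 2) hCA
    refine le_of_mul_le_mul_left ?_ hα0
    linarith
  have hνCA : ν * K.CA ≤ θ := by
    have h1 : 0 ≤ ν * (4 * (B₁ + B₂) + 1) := by positivity
    have h2 : θ ^ 2 ≤ θ := by nlinarith
    linarith
  have hdouble := hv₁.sub_le_of_max hv₂ hc0 hα0.le hν0.le (hmax k)
  have hfrob₁ := mul_le_mul_of_nonneg_left (K.frobSq_sub_le_sq k a b) hα0.le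
  have hfrob₂ := mul_le_mul_of_nonneg_left (K.frobSq_le k b) hν0.le
  set s₁ : Fin (m + 1) → ℝ := fun j => v₁ k a - v₁ j a with hs₁
  have hs₁M : ∀ j, |s₁ j| ≤ M := fun j =>
    abs_le.2 ⟨by linarith [hM₁ j k a], hM₁ k j a⟩
  set P := p₂ + (1 : ℝ) • (α • (a - b) - ν • (b - y₁)) with hP
  have hmono : S.H k P (fun _ => r₂) (fun j => v₂ k b - v₂ j b) b ω ≤
      S.H k P (fun _ => r₂) (c • s₁) b ω :=
    S.H_monotone_s k P _ b ω fun j => by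
      change v₂ k b - v₂ j b ≤ c * (v₁ k a - v₁ j a)
      linarith [hmax j a b]
  have hcont := (abs_le.1 (K.abs_sub_le (R + M) (by positivity) k P r₂ r₁ (c • s₁) s₁ b a
    (by linarith) (by linarith) (fun j => by
      rw [Pi.smul_apply, smul_eq_mul, abs_mul, abs_of_pos hc0]
      have := mul_le_of_le_one_left (abs_nonneg (s₁ j)) hc1
      linarith [hs₁M j]) (fun j => by linarith [hs₁M j]))).2
  have hs₁norm : ‖c • s₁ - s₁‖ ≤ θ * M := by
    refine (pi_norm_le_iff_of_nonneg (by positivity)).2 fun j => ?_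
    have : (c • s₁ - s₁) j = -(θ * s₁ j) := by
      rw [Pi.sub_apply, Pi.smul_apply, smul_eq_mul, hc]
      ring
    rw [this, norm_neg, norm_mul, Real.norm_of_nonneg hθ0.le]
    exact mul_le_mul_of_nonneg_left (hs₁M j) hθ0.le
  rw [norm_sub_rev b a, abs_sub_comm r₂ r₁] at hcont
  have hcont' := mul_le_mul_of_nonneg_left hs₁norm hC₅
  set e : Euc n := θ⁻¹ • (p₂ - c • p₁ - ν • (b - y₁)) with he
  have henorm : ‖e‖ ≤ R + 2 := by
    have h1 : p₂ - c • p₁ - ν • (b - y₁) = θ • p₁ - (p₁ - p₂) - ν • (b - y₁) := by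
      rw [hc]
      module
    have h2 := norm_sub_le (θ • p₁ - (p₁ - p₂)) (ν • (b - y₁))
    have h3 := norm_sub_le (θ • p₁) (p₁ - p₂)
    have h4 : ‖θ • p₁‖ ≤ θ * R := by
      rw [norm_smul, Real.norm_of_nonneg hθ0.le]
      exact mul_le_mul_of_nonneg_left hp₁ hθ0.le
    rw [he, norm_smul, h1, Real.norm_of_nonneg (inv_nonneg.2 hθ0.le), inv_mul_le_iff₀ hθ0]
    linarith
  have hconv := (S.H_convex_p k (fun _ => r₁) s₁ a ω).2
    (Set.mem_univ (p₁ + c⁻¹ • α • (a - b))) (Set.mem_univ e) hc0.le hθ0.le (by rw [hc]; ring)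
  have hPe : c • (p₁ + c⁻¹ • α • (a - b)) + θ • e = P := by
    rw [hP, he, smul_add, smul_inv_smul₀ hc0.ne', smul_inv_smul₀ hθ0.ne']
    module
  rw [hPe, smul_eq_mul, smul_eq_mul] at hconv
  have hHe := (abs_le.1 (K.abs_le (R + 2 + M) (by positivity) k e r₁ s₁ a (by linarith) hr₁
    fun j => by linarith [hs₁M j])).2
  have hHe' := mul_le_mul_of_nonneg_left hHe hθ0.le
  have hδbase : δ * (c * v₁ k₁ y₁ - v₂ k₁ y₁) ≤ δ * (c * v₁ k a - v₂ k b) :=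
    mul_le_mul_of_nonneg_left (by linarith) hδ.le
  have h1 : 0 ≤ (K.C₄ (R + 2 + M) + K.C₅ (R + M) * M + 2) * |r₁ - r₂| := by positivity
  have h2 : 0 ≤ K.C₅ (R + M) * θ := by positivity
  linarith

/-- One-sided continuous dependence of the macroscopic solutions, uniformly in the parameters. -/
theorem exists_mul_sub_mul_le (S : Setting n (m + 1)) (hR : 0 < R) (ω : S.Ω) :
    ∃ C : ℝ, 0 < C ∧ ∀ (p₁ p₂ : Euc n) (r₁ r₂ : ℝ), ‖p₁‖ ≤ R → ‖p₂‖ ≤ R → |r₁| ≤ R → |r₂| ≤ R →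
      ∀ δ : ℝ, 0 < δ → ∀ v₁ v₂ : Fin (m + 1) → Euc n → ℝ,
        IsMacroSoln S p₁ r₁ δ ω v₁ → IsMacroSoln S p₂ r₂ δ ω v₂ →
          ∀ k y, δ * v₁ k y - δ * v₂ k y ≤ C * (‖p₁ - p₂‖ + |r₁ - r₂|) := by
  obtain ⟨K⟩ := nonempty_cellBounds S ω hR
  obtain ⟨M, hM, hMle⟩ := K.exists_sub_le
  have hB₀ := K.B₀_nonneg
  have hC₄ := K.C₄_nonneg (R + 2 + M)
  have hC₅ := K.C₅_nonneg (R + M)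
  set E := K.C₄ (R + 2 + M) + K.C₅ (R + M) * (1 + M) + 2 with hE
  have hE0 : 0 < E := by positivity
  refine ⟨2 * K.B₀ + E, by positivity, fun p₁ p₂ r₁ r₂ hp₁ hp₂ hr₁ hr₂ δ hδ v₁ v₂ hv₁ hv₂ k y =>
    ?_⟩
  have h1 := (abs_le.1 (hv₁.abs_mul_le K hδ hp₁ hr₁ k y)).2
  have h2 := (abs_le.1 (hv₂.abs_mul_le K hδ hp₂ hr₂ k y)).1
  rw [← div_le_iff₀' (by positivity), ← sub_le_iff_le_add]
  refine le_of_forall_gt_imp_ge_of_dense fun θ hθ => ?_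
  rw [sub_le_iff_le_add, div_le_iff₀' (by positivity)]
  have hr0 := abs_nonneg (r₁ - r₂)
  have hθ0 : 0 < θ := (norm_nonneg _).trans_lt hθ
  rcases lt_or_ge θ 1 with hθ1 | hθ1
  · have h3 := IsMacroSoln.mul_sub_le K hM hδ hp₁ hr₁ hr₂ hv₁ hv₂
      (hMle p₁ r₁ δ v₁ hδ hp₁ hr₁ hv₁) hθ.le hθ0 hθ1 k y
    have h4 := mul_le_mul_of_nonneg_left h1 hθ0.le
    have h5 : 0 ≤ K.B₀ * θ := by positivity
    have h6 : 0 ≤ K.B₀ * |r₁ - r₂| := by positivity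
    linarith
  · have h3 : (2 * K.B₀ + E) * 1 ≤ (2 * K.B₀ + E) * (θ + |r₁ - r₂|) :=
      mul_le_mul_of_nonneg_left (by linarith) (by positivity)
    linarith

end

/-- Continuous dependence of the approximate macroscopic solutions on `(p, r)`. -/
theorem stmt1 {n m : ℕ} (S : Setting n (m + 1)) :
    ∀ R : ℝ, 0 < R → ∀ ω : S.Ω, ∃ C : ℝ, 0 < C ∧
      ∀ (p₁ p₂ : Euc n) (r₁ r₂ : ℝ), ‖p₁‖ ≤ R → ‖p₂‖ ≤ R → |r₁| ≤ R → |r₂| ≤ R →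
        ∀ δ : ℝ, 0 < δ → ∀ v₁ v₂ : Fin (m + 1) → Euc n → ℝ,
          IsMacroSoln S p₁ r₁ δ ω v₁ → IsMacroSoln S p₂ r₂ δ ω v₂ →
            ∀ (k : Fin (m + 1)) (y : Euc n),
              |δ * v₁ k y - δ * v₂ k y| ≤
                C * Finset.univ.sup' Finset.univ_nonempty (fun i : Fin (m + 1) =>
                  (1 + ‖p₁‖ + ‖p₂‖) ^ (S.γ i - 1) * ‖p₁ - p₂‖ + |r₁ - r₂|) := by
  intro R hR ω
  obtain ⟨C, hC, hle⟩ := exists_mul_sub_mul_le S hR ω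
  refine ⟨C, hC, fun p₁ p₂ r₁ r₂ hp₁ hp₂ hr₁ hr₂ δ hδ v₁ v₂ hv₁ hv₂ k y => ?_⟩
  have h1 := hle p₁ p₂ r₁ r₂ hp₁ hp₂ hr₁ hr₂ δ hδ v₁ v₂ hv₁ hv₂ k y
  have h2 := hle p₂ p₁ r₂ r₁ hp₂ hp₁ hr₂ hr₁ δ hδ v₂ v₁ hv₂ hv₁ k y
  rw [norm_sub_rev, abs_sub_comm r₂ r₁] at h2
  refine le_trans (abs_sub_le_iff.2 ⟨h1, h2⟩) (mul_le_mul_of_nonneg_left ?_ hC.le)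
  refine le_trans ?_ (Finset.le_sup' (fun i : Fin (m + 1) =>
    (1 + ‖p₁‖ + ‖p₂‖) ^ (S.γ i - 1) * ‖p₁ - p₂‖ + |r₁ - r₂|) (Finset.mem_univ k))
  have h3 : 1 ≤ (1 + ‖p₁‖ + ‖p₂‖) ^ (S.γ k - 1) :=
    Real.one_le_rpow (by linarith [norm_nonneg p₁, norm_nonneg p₂])
      (sub_nonneg.2 (S.γ_gt_one k).le)
  exact add_le_add_left (le_mul_of_one_le_left (norm_nonneg _) h3) _
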